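/- arXiv:math/0607233 — 4 statements merged into one kernel-verified Lean document; each statement's English description precedes it below -/
import Mathlib

section
/- Fix an integer d ≥ 2 and constants c > 0, C ≥ 1. There exist K ≥ 1 and ε_0 > 0 such that for every ε ∈ (0,ε_0) there exists δ_0 > 0 with the following property for all δ ∈ (0,δ_0). In the pinned setup, for every integer 1 ≤ k ≤ d, every affine subspace H ⊆ ℝ^d of dimension d−k, and every ρ ∈ [δ,1], one has vol({ y ∈ F : dist(y,H) ≤ ρ }) ≤ δ^{(d/2) − Kε} · ρ^{k/2}; in particular vol({ y ∈ F : dist(y,H) ≤ δ }) ≤ δ^{(k+d)/2 − Kε}. -/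
open MeasureTheory Metric Set
open scoped ENNReal

noncomputable section

abbrev Euc (d : ℕ) : Type := EuclideanSpace ℝ (Fin d)

/-- `A ⊆ ℝ` is a `(δ,ρ)_1` set with constant `C`. -/
def IsDeltaRhoSet1 (δ ρ C : ℝ) (A : Set ℝ) : Prop :=
  ∀ (x r : ℝ), δ ≤ r →
    volume (A ∩ closedBall x r) ≤ ENNReal.ofReal (C * δ ^ (1 - ρ) * r ^ ρ)

/-- A finite spanning family contains a basis in which all its members have coefficients at most `1`
in absolute value: choose the basis of maximal determinant. -/
theorem exists_dominating_subfamily_of_span_eq_top {ι W : Type*} [Finite ι] [AddCommGroup W]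
    [Module ℝ W] [FiniteDimensional ℝ W] (f : ι → W) (hf : Submodule.span ℝ (range f) = ⊤) :
    ∃ g : Fin (Module.finrank ℝ W) → ι, ∀ j, ∃ a : Fin (Module.finrank ℝ W) → ℝ,
      (∀ i, |a i| ≤ 1) ∧ f j = ∑ i, a i • f (g i) := by
  classical
  let e := Module.finBasis ℝ W
  obtain ⟨κ, a, ha, hspan, hli⟩ := exists_linearIndependent' ℝ f
  have hspan' : ⊤ ≤ Submodule.span ℝ (range (f ∘ a)) := by rw [hspan, hf]
  let b := Module.Basis.mk hli hspan'
  have : Finite κ := Finite.of_injective a ha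
  let σ := b.indexEquiv e
  let g₀ : Fin (Module.finrank ℝ W) → ι := a ∘ σ.symm
  have hg₀ : e.det (f ∘ g₀) ≠ 0 := by
    have h : f ∘ g₀ = b.reindex σ := by
      ext i
      simp [g₀, b]
    rw [h]
    exact (e.isUnit_det _).ne_zero
  have : Nonempty (Fin (Module.finrank ℝ W) → ι) := ⟨g₀⟩
  obtain ⟨g, hg⟩ := Finite.exists_max fun g : Fin (Module.finrank ℝ W) → ι => |e.det (f ∘ g)|
  have hdet : 0 < |e.det (f ∘ g)| := (abs_pos.2 hg₀).trans_le (hg g₀)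
  obtain ⟨hli', hsp'⟩ := e.is_basis_iff_det.2 (isUnit_iff_ne_zero.2 (abs_pos.1 hdet))
  let B := Module.Basis.mk hli' hsp'.ge
  refine ⟨g, fun j => ⟨fun i => B.repr (f j) i, fun i => ?_, ?_⟩⟩
  · have h := LinearMap.congr_fun (e.det_smul_mk_coord_eq_det_update hli' hsp'.ge i) (f j)
    have h' : Function.update (f ∘ g) i (f j) = f ∘ Function.update g i j :=
      (Function.comp_update f g i j).symm
    have h2 : e.det (f ∘ g) * B.repr (f j) i = e.det (f ∘ Function.update g i j) := by
      rw [← h']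
      exact h
    have h3 := hg (Function.update g i j)
    simp only [← h2, abs_mul] at h3
    exact le_of_mul_le_mul_left (by simpa using h3) hdet
  · conv_lhs => rw [← B.sum_repr (f j)]
    simp [B]

/-- Among finitely many functionals on `V`, at most `dim V` of them control all the others, with
constant `dim V`. -/
theorem exists_dominating_finset {ι V : Type*} [Finite ι] [AddCommGroup V]
    [Module ℝ V] [FiniteDimensional ℝ V] (f : ι → Module.Dual ℝ V) :
    ∃ S : Finset ι, S.card ≤ Module.finrank ℝ V ∧ ∀ (h : V) (B : ℝ), 0 ≤ B →
      (∀ i ∈ S, |f i h| ≤ B) → ∀ j, |f j h| ≤ Module.finrank ℝ V * B := by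
  classical
  let U := Submodule.span ℝ (range f)
  let f' : ι → U := fun i => ⟨f i, Submodule.subset_span ⟨i, rfl⟩⟩
  obtain ⟨g, hg⟩ := exists_dominating_subfamily_of_span_eq_top f' (by
    rw [← Submodule.span_span_coe_preimage (R := ℝ) (s := range f)]
    congr 1
    ext ⟨u, hu⟩
    simp [f'])
  have hU : Module.finrank ℝ U ≤ Module.finrank ℝ V :=
    (Submodule.finrank_le U).trans_eq Subspace.dual_finrank_eq
  refine ⟨Finset.univ.image g, ?_, fun h B hB hS j => ?_⟩
  · exact Finset.card_image_le.trans (by simpa using hU)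
  · obtain ⟨a, ha, hj⟩ := hg j
    have hj' : f j = ∑ i, a i • f (g i) := by
      simpa [f'] using congrArg Subtype.val hj
    calc |f j h| = |∑ i, a i * f (g i) h| := by rw [hj']; simp
      _ ≤ ∑ i, |a i * f (g i) h| := Finset.abs_sum_le_sum_abs _ _
      _ ≤ ∑ _i : Fin (Module.finrank ℝ U), B := by
          refine Finset.sum_le_sum fun i _ => ?_
          rw [abs_mul]
          have := hS (g i) (by simp)
          nlinarith [ha i, abs_nonneg (f (g i) h), abs_nonneg (a i)]
      _ = Module.finrank ℝ U * B := by simp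
      _ ≤ _ := by gcongr

/-- If the coordinates in `S` determine all coordinates of points of `G ⊆ D^d` up to `R` at scale
`ρ`, then `G` has the measure of `D^S` times that of `D` on intervals of radius `R`. -/
theorem volume_le_of_controlled_coordinates {d : ℕ} (G : Set (Fin d → ℝ)) (D : Set ℝ)
    (S : Finset (Fin d)) {ρ R : ℝ} (hρ : 0 < ρ) {M : ℝ≥0∞} (hGD : ∀ t ∈ G, ∀ i, t i ∈ D)
    (hG : ∀ t ∈ G, ∀ t' ∈ G, (∀ i ∈ S, |t i - t' i| ≤ ρ) → ∀ i, |t i - t' i| ≤ R)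
    (hM : ∀ a, volume (D ∩ closedBall a R) ≤ M) :
    volume G ≤ volume D ^ S.card * M ^ (d - S.card) := by
  classical
  let I : ℤ → Set ℝ := fun n => {s | ⌊s / ρ⌋ = n}
  have hI : ∀ n, MeasurableSet (I n) := fun n =>
    (measurableSet_singleton n).preimage (by fun_prop : Measurable fun s : ℝ => ⌊s / ρ⌋)
  let cell : (S → ℤ) → Set (Fin d → ℝ) := fun n => {t | ∀ i : S, t i ∈ I (n i)}
  have hcell : ∀ n, volume (G ∩ cell n) ≤
      (∏ i : S, volume (D ∩ I (n i))) * M ^ (d - S.card) := by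
    intro n
    rcases (G ∩ cell n).eq_empty_or_nonempty with h | ⟨t₀, ht₀, hn₀⟩
    · simp [h]
    let T : Fin d → Set ℝ := fun i =>
      if h : i ∈ S then D ∩ I (n ⟨i, h⟩) else D ∩ closedBall (t₀ i) R
    have hsub : G ∩ cell n ⊆ univ.pi T := by
      rintro t ⟨ht, hn⟩ i -
      by_cases hi : i ∈ S
      · simp only [T, hi, dif_pos]
        exact ⟨hGD t ht i, hn ⟨i, hi⟩⟩
      · simp only [T, hi, dif_neg, not_false_eq_true]
        refine ⟨hGD t ht i, ?_⟩
        rw [mem_closedBall, Real.dist_eq]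
        refine hG t ht t₀ ht₀ (fun j hj => ?_) i
        have h1 : ⌊t j / ρ⌋ = ⌊t₀ j / ρ⌋ := (hn ⟨j, hj⟩).trans (hn₀ ⟨j, hj⟩).symm
        have h2 := (Int.abs_sub_lt_one_of_floor_eq_floor h1).le
        rwa [← sub_div, abs_div, abs_of_pos hρ, div_le_one hρ] at h2
    calc volume (G ∩ cell n) ≤ volume (univ.pi T) := measure_mono hsub
      _ = ∏ i, volume (T i) := volume_pi_pi _
      _ = (∏ i ∈ S, volume (T i)) * ∏ i ∈ Sᶜ, volume (T i) := (Finset.prod_mul_prod_compl _ _).symm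
      _ ≤ (∏ i : S, volume (D ∩ I (n i))) * M ^ (d - S.card) := by
          refine mul_le_mul' ?_ ?_
          · rw [← Finset.prod_coe_sort]
            exact (Finset.prod_congr rfl fun i _ => by simp [T]).le
          · have : d - S.card = Sᶜ.card := by simp [Finset.card_compl]
            rw [this]
            refine Finset.prod_le_pow_card _ _ _ fun i hi => ?_
            simp only [Finset.mem_compl] at hi
            simp only [T, hi, dif_neg, not_false_eq_true]
            exact hM _
  let μ : Measure (S → ℝ) := Measure.pi fun _ => volume.restrict D
  have hsum : ∑' n : S → ℤ, ∏ i : S, volume (D ∩ I (n i)) ≤ volume D ^ S.card := by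
    calc ∑' n : S → ℤ, ∏ i : S, volume (D ∩ I (n i))
        = ∑' n : S → ℤ, μ (univ.pi fun i => I (n i)) := by
          refine tsum_congr fun n => ?_
          rw [Measure.pi_pi]
          exact Finset.prod_congr rfl fun i _ => by rw [Measure.restrict_apply (hI _), inter_comm]
      _ ≤ μ univ := by
          refine tsum_measure_le_measure_univ
            (fun n => (MeasurableSet.univ_pi fun i => hI _).nullMeasurableSet) ?_
          intro n m hnm
          refine Disjoint.aedisjoint (Set.disjoint_left.2 fun t ht ht' => hnm ?_)
          funext i
          exact (ht i trivial).symm.trans (ht' i trivial)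
      _ = volume D ^ S.card := by
          rw [← pi_univ univ, Measure.pi_pi]
          simp
  calc volume G ≤ volume (⋃ n, G ∩ cell n) :=
        measure_mono fun t ht => mem_iUnion.2 ⟨fun i => ⌊t i / ρ⌋, ht, fun i => rfl⟩
    _ ≤ ∑' n, volume (G ∩ cell n) := measure_iUnion_le _
    _ ≤ ∑' n : S → ℤ, (∏ i : S, volume (D ∩ I (n i))) * M ^ (d - S.card) :=
        ENNReal.tsum_le_tsum hcell
    _ ≤ _ := by
        rw [ENNReal.tsum_mul_right]
        gcongr

theorem volume_le_of_expanding {d : ℕ} (E : Set (Euc d))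
    (Φ : Euc d → Fin d → ℝ) (L : NNReal)
    (h : ∀ y ∈ E, ∀ y' ∈ E, dist y y' ≤ L * dist (Φ y) (Φ y')) :
    volume E ≤ (L : ℝ≥0∞) ^ d * volume (Φ '' E) := by
  let Ψ : (Fin d → ℝ) → (Fin d → ℝ) := fun t => (Function.invFunOn Φ E t).ofLp
  have hinv : ∀ y ∈ E, Function.invFunOn Φ E (Φ y) = y := fun y hy => by
    have hex : ∃ a ∈ E, Φ a = Φ y := ⟨y, hy, rfl⟩
    have := h _ (Function.invFunOn_mem hex) y hy
    rw [Function.invFunOn_eq hex, dist_self, mul_zero] at this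
    exact dist_le_zero.1 this
  have hΨ : LipschitzOnWith L Ψ (Φ '' E) := by
    refine LipschitzOnWith.of_dist_le_mul ?_
    rintro _ ⟨y, hy, rfl⟩ _ ⟨y', hy', rfl⟩
    simp only [Ψ, hinv y hy, hinv y' hy']
    refine le_trans ?_ (h y hy y' hy')
    simpa using (PiLp.lipschitzWith_ofLp 2 (fun _ : Fin d => ℝ)).dist_le_mul y y'
  have himage : Ψ '' (Φ '' E) = WithLp.ofLp '' E := by
    rw [image_image]
    exact image_congr fun y hy => by simp only [Ψ, hinv y hy]
  have hvol : volume E = volume (WithLp.ofLp '' E) := by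
    have := (EuclideanSpace.volume_preserving_symm_measurableEquiv_toLp (Fin d)).measure_preimage_equiv
      (WithLp.ofLp '' E)
    rw [← this]
    congr 1
    exact (preimage_image_eq _ (WithLp.ofLp_injective 2)).symm
  have := hΨ.hausdorffMeasure_image_le (d := d) (by positivity)
  have hd : (Measure.hausdorffMeasure (d : ℝ) : Measure (Fin d → ℝ)) = volume := by
    simpa using hausdorffMeasure_pi_real (ι := Fin d)
  rwa [himage, hd, ← hvol, ENNReal.rpow_natCast] at this

/-- Quantitative injectivity of `h ↦ (⟪v j, h⟫)_j`, from Cramer's rule. -/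
theorem norm_le_of_abs_inner_le {d : ℕ} {c C : ℝ} (hc : 0 < c) (hC : 1 ≤ C)
    (v : Fin d → Euc d) (hv : ∀ j, ‖v j‖ ≤ C)
    (hdet : c ≤ |Matrix.det (Matrix.of fun i j : Fin d => v j i)|)
    (h : Euc d) {s : ℝ} (hs : ∀ j, |inner ℝ (v j) h| ≤ s) :
    ‖h‖ ≤ d * (d * (d.factorial * C ^ d / c)) * s := by
  set A : Matrix (Fin d) (Fin d) ℝ := Matrix.of fun i j => v j i with hA
  have hentry : ∀ i j, |A i j| ≤ C := fun i j =>
    ((Real.norm_eq_abs _).symm.trans_le (PiLp.norm_apply_le (v j) i)).trans (hv j)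
  have hadj : ∀ i j, |A.adjugate i j| ≤ d.factorial * C ^ d := by
    intro i j
    rw [Matrix.adjugate_apply]
    have := Matrix.det_le (A := A.updateRow j (Pi.single i 1)) (abv := AbsoluteValue.abs) (x := C) ?_
    · simpa using this
    · intro a b
      simp only [Matrix.updateRow_apply, AbsoluteValue.abs_apply]
      split_ifs
      · by_cases hb : b = i
        · simpa [hb] using hC
        · simpa [hb] using zero_le_one.trans hC
      · exact hentry a b
  have hvec : ∀ j, Matrix.vecMul h.ofLp A j = inner ℝ (v j) h := by
    intro j
    simp [Matrix.vecMul, dotProduct, PiLp.inner_apply, hA]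
  have hcoord : ∀ i, |h i| ≤ d * (d.factorial * C ^ d / c * s) := by
    intro i
    have h1 : A.det * h i = ∑ j, inner ℝ (v j) h * A.adjugate j i := by
      have : Matrix.vecMul (Matrix.vecMul h.ofLp A) A.adjugate = A.det • h.ofLp := by
        rw [Matrix.vecMul_vecMul, Matrix.mul_adjugate, Matrix.vecMul_smul, Matrix.vecMul_one]
      have := congrFun this i
      simp only [Pi.smul_apply, smul_eq_mul] at this
      rw [← this]
      simp only [Matrix.vecMul, dotProduct] at hvec ⊢
      simp only [hvec]
    have h2 : c * |h i| ≤ d * (s * (d.factorial * C ^ d)) := by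
      calc c * |h i| ≤ |A.det| * |h i| := by gcongr
        _ = |∑ j, inner ℝ (v j) h * A.adjugate j i| := by rw [← abs_mul, h1]
        _ ≤ ∑ j, |inner ℝ (v j) h * A.adjugate j i| := Finset.abs_sum_le_sum_abs _ _
        _ ≤ ∑ _j : Fin d, s * (d.factorial * C ^ d) := by
            refine Finset.sum_le_sum fun j _ => ?_
            rw [abs_mul]
            exact mul_le_mul (hs j) (hadj j i) (abs_nonneg _) ((abs_nonneg _).trans (hs j))
        _ = _ := by simp
    calc |h i| ≤ (d * (s * (d.factorial * C ^ d))) / c := by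
          rw [le_div_iff₀ hc]; linarith
      _ = _ := by ring
  calc ‖h‖ = ‖∑ i, EuclideanSpace.single i (h i)‖ := by
        congr 1
        ext j
        simp [Finset.sum_apply, Pi.single_apply]
    _ ≤ ∑ i, ‖EuclideanSpace.single i (h i)‖ := norm_sum_le _ _
    _ = ∑ i, |h i| := by simp
    _ ≤ ∑ _i : Fin d, d * (d.factorial * C ^ d / c * s) := Finset.sum_le_sum fun i _ => hcoord i
    _ = _ := by
        simp only [Finset.sum_const, Finset.card_univ, Fintype.card_fin, nsmul_eq_mul]
        ring

theorem abs_inner_sub_midpoint_le {E : Type*} [NormedAddCommGroup E] [InnerProductSpace ℝ E]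
    {C : ℝ} {x y y' : E} (hy : dist y x ≤ C) (hy' : dist y' x ≤ C) :
    |inner ℝ (x - midpoint ℝ y y') (y - y')| ≤ C * |dist y x - dist y' x| := by
  have h : inner ℝ (x - midpoint ℝ y y') (y - y')
      = -(((dist y x + dist y' x) / 2) * (dist y x - dist y' x)) := by
    have h1 : x - midpoint ℝ y y' = -((1 / 2 : ℝ) • ((y - x) + (y' - x))) := by
      rw [midpoint_eq_smul_add, invOf_eq_inv]
      module
    have h2 : y - y' = (y - x) - (y' - x) := by abel
    rw [h1, h2, dist_eq_norm, dist_eq_norm, inner_neg_left, real_inner_smul_left]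
    generalize y - x = u, y' - x = w
    rw [inner_add_left, inner_sub_right, inner_sub_right, real_inner_self_eq_norm_sq,
      real_inner_self_eq_norm_sq, real_inner_comm u w]
    ring
  rw [h, abs_neg, abs_mul, abs_of_nonneg (by positivity)]
  gcongr
  linarith

theorem dist_le_of_det_bound {d : ℕ} {K c C : ℝ}
    (hK : ∀ v : Fin d → Euc d, (∀ j, ‖v j‖ ≤ C) →
      c ≤ |Matrix.det (Matrix.of fun i j : Fin d => v j i)| →
      ∀ (h : Euc d) (s : ℝ), (∀ j, |inner ℝ (v j) h| ≤ s) → ‖h‖ ≤ K * s)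
    (x : Fin d → Euc d) (hC : 0 ≤ C) {y y' : Euc d}
    (hdet : c ≤ |Matrix.det (Matrix.of fun i j : Fin d => (x j - midpoint ℝ y y') i)|)
    (hy : ∀ j, dist y (x j) ≤ C) (hy' : ∀ j, dist y' (x j) ≤ C) :
    dist y y' ≤ K * C * dist (fun j => dist y (x j)) (fun j => dist y' (x j)) := by
  have hm : ∀ j, ‖x j - midpoint ℝ y y'‖ ≤ C := fun j => by
    rw [← dist_eq_norm, dist_comm]
    exact (convex_closedBall (x j) C).midpoint_mem (hy j) (hy' j)
  rw [dist_eq_norm, mul_assoc]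
  refine hK _ hm hdet _ _ fun j => (abs_inner_sub_midpoint_le (hy j) (hy' j)).trans ?_
  gcongr
  exact dist_le_pi_dist (fun j => dist y (x j)) (fun j => dist y' (x j)) j

/-- On a small piece of a `ρ`-neighbourhood of `H`, some `dim H` of the distances to the points `x j`
determine the position at scale `ρ`. -/
theorem exists_controlling_coordinates {d : ℕ} {K c C ρ : ℝ} (hC : 1 ≤ C)
    (hρ : 0 < ρ)
    (hK : ∀ v : Fin d → Euc d, (∀ j, ‖v j‖ ≤ C) →
      c ≤ |Matrix.det (Matrix.of fun i j : Fin d => v j i)| →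
      ∀ (h : Euc d) (s : ℝ), (∀ j, |inner ℝ (v j) h| ≤ s) → ‖h‖ ≤ K * s)
    (x : Fin d → Euc d) {B E : Set (Euc d)} (hEB : E ⊆ B)
    (hdet : ∀ m ∈ B, c ≤ |Matrix.det (Matrix.of fun i j : Fin d => (x j - m) i)|)
    (hE : ∀ y ∈ E, ∀ j, dist y (x j) ≤ C) {r : ℝ} (hr : K * d * r ≤ 1 / 2)
    (hEr : ∀ y ∈ E, ∀ y' ∈ E, dist y y' ≤ r)
    (H : AffineSubspace ℝ (Euc d)) (hH : (H : Set (Euc d)).Nonempty)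
    (hEH : ∀ y ∈ E, infDist y (H : Set (Euc d)) ≤ ρ) :
    ∃ S : Finset (Fin d), S.card ≤ Module.finrank ℝ H.direction ∧
      ∀ y ∈ E, ∀ y' ∈ E, (∀ j ∈ S, |dist y (x j) - dist y' (x j)| ≤ ρ) →
        dist y y' ≤ (10 * K * d * C + 4) * ρ := by
  rcases E.eq_empty_or_nonempty with rfl | ⟨y₀, hy₀⟩
  · exact ⟨∅, by simp, by simp⟩
  obtain ⟨S, hScard, hS⟩ := exists_dominating_finset fun j : Fin d =>
    (innerSL ℝ (x j - y₀)).toLinearMap ∘ₗ H.direction.subtype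
  refine ⟨S, hScard, fun y hy y' hy' hyS => ?_⟩
  have hfin : (Module.finrank ℝ H.direction : ℝ) ≤ d := by
    exact_mod_cast (Submodule.finrank_le H.direction).trans_eq finrank_euclideanSpace_fin
  obtain ⟨p, hp, hyp⟩ := (infDist_lt_iff hH).1 ((hEH y hy).trans_lt (by linarith : ρ < 2 * ρ))
  obtain ⟨p', hp', hyp'⟩ := (infDist_lt_iff hH).1 ((hEH y' hy').trans_lt (by linarith : ρ < 2 * ρ))
  set m := midpoint ℝ y y' with hm
  have hmC : ∀ j, ‖x j - m‖ ≤ C := fun j => by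
    rw [← dist_eq_norm, dist_comm]
    exact (convex_closedBall (x j) C).midpoint_mem (hE y hy j) (hE y' hy' j)
  have hmr : ‖m - y₀‖ ≤ r := by
    rw [← dist_eq_norm]
    exact (convex_closedBall y₀ r).midpoint_mem (hEr y hy _ hy₀) (hEr y' hy' _ hy₀)
  have hpp : p - p' ∈ H.direction := AffineSubspace.vsub_mem_direction hp hp'
  have he : ‖(y - y') - (p - p')‖ ≤ 4 * ρ := by
    have h1 : (y - y') - (p - p') = (y - p) - (y' - p') := by abel
    rw [dist_eq_norm] at hyp hyp'
    rw [h1]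
    exact (norm_sub_le _ _).trans (by linarith)
  have hsmall : ∀ j ∈ S, |inner ℝ (x j - y₀) (p - p')| ≤ 5 * C * ρ + r * ‖p - p'‖ := by
    intro j hj
    have h1 : inner ℝ (x j - y₀) (p - p') = inner ℝ (x j - m) (y - y')
        - inner ℝ (x j - m) ((y - y') - (p - p')) + inner ℝ (m - y₀) (p - p') := by
      rw [← inner_sub_right, ← sub_add_sub_cancel (x j) m y₀, inner_add_left]
      congr 2
      abel
    have h2 : |inner ℝ (x j - m) (y - y')| ≤ C * ρ :=
      (abs_inner_sub_midpoint_le (hE y hy j) (hE y' hy' j)).trans (by gcongr; exact hyS j hj)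
    have h3 : |inner ℝ (x j - m) ((y - y') - (p - p'))| ≤ C * (4 * ρ) :=
      (abs_real_inner_le_norm _ _).trans (by gcongr; exact hmC j)
    have h4 : |inner ℝ (m - y₀) (p - p')| ≤ r * ‖p - p'‖ :=
      (abs_real_inner_le_norm _ _).trans (by gcongr)
    rw [h1]
    refine (abs_add_le _ _).trans ?_
    have := abs_sub (inner ℝ (x j - m) (y - y')) (inner ℝ (x j - m) ((y - y') - (p - p')))
    linarith
  have hB : 0 ≤ 5 * C * ρ + r * ‖p - p'‖ := by
    have : 0 ≤ r := (norm_nonneg _).trans hmr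
    positivity
  have hall : ∀ j, |inner ℝ (x j - y₀) (p - p')| ≤ d * (5 * C * ρ + r * ‖p - p'‖) := fun j =>
    (hS ⟨p - p', hpp⟩ _ hB hsmall j).trans (by gcongr)
  have hnorm : ‖p - p'‖ ≤ K * (d * (5 * C * ρ + r * ‖p - p'‖)) :=
    hK (fun j => x j - y₀)
      (fun j => by rw [← dist_eq_norm, dist_comm]; exact hE y₀ hy₀ j) (hdet y₀ (hEB hy₀)) _ _ hall
  have hnorm' : ‖p - p'‖ ≤ 10 * K * d * C * ρ := by
    have := mul_le_mul_of_nonneg_right hr (norm_nonneg (p - p'))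
    linarith
  calc dist y y' = ‖(p - p') + ((y - y') - (p - p'))‖ := by rw [dist_eq_norm]; congr 1; abel
    _ ≤ ‖p - p'‖ + ‖(y - y') - (p - p')‖ := norm_add_le _ _
    _ ≤ _ := by linarith

theorem volume_plate_le_of_dist_le {d k : ℕ} (hd : 1 ≤ d) {K c C δ ρ : ℝ} (hK0 : 1 ≤ K)
    (hC : 1 ≤ C) (hδ : 0 < δ) (hδρ : δ ≤ ρ) (hρ : ρ ≤ 1) (hkd : k ≤ d)
    (hK : ∀ v : Fin d → Euc d, (∀ j, ‖v j‖ ≤ C) →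
      c ≤ |Matrix.det (Matrix.of fun i j : Fin d => v j i)| →
      ∀ (h : Euc d) (s : ℝ), (∀ j, |inner ℝ (v j) h| ≤ s) → ‖h‖ ≤ K * s)
    (x : Fin d → Euc d) {B E : Set (Euc d)} (hB : Convex ℝ B) (hEB : E ⊆ B)
    (hdet : ∀ m ∈ B, c ≤ |Matrix.det (Matrix.of fun i j : Fin d => (x j - m) i)|)
    {D : Set ℝ} (hDC : D ⊆ Icc 0 C) (hD : IsDeltaRhoSet1 δ (1 / 2) C D)
    (hE : ∀ y ∈ E, ∀ j, dist y (x j) ∈ D) {r : ℝ} (hr : K * d * r ≤ 1 / 2)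
    (hEr : ∀ y ∈ E, ∀ y' ∈ E, dist y y' ≤ r)
    (H : AffineSubspace ℝ (Euc d)) (hH : (H : Set (Euc d)).Nonempty)
    (hHk : Module.finrank ℝ H.direction = d - k)
    (hEH : ∀ y ∈ E, infDist y (H : Set (Euc d)) ≤ ρ) :
    volume E ≤ ENNReal.ofReal ((K * C) ^ d * (C * (10 * K * d * C + 4) ^ (1 / 2 : ℝ)) ^ d *
      (δ ^ ((d : ℝ) / 2) * ρ ^ ((k : ℝ) / 2))) := by
  have hρ0 : 0 < ρ := hδ.trans_le hδρ
  have hEC : ∀ y ∈ E, ∀ j, dist y (x j) ≤ C := fun y hy j => (hDC (hE y hy j)).2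
  obtain ⟨S, hS, hctrl⟩ := exists_controlling_coordinates hC hρ0 hK x hEB hdet hEC hr hEr
    H hH hEH
  set Q := 10 * K * d * C + 4 with hQ
  have hQC : C ≤ Q := by
    have h1 : (1 : ℝ) ≤ d := by exact_mod_cast hd
    have h2 : 1 ≤ K * d := one_le_mul_of_one_le_of_one_le hK0 h1
    nlinarith
  have hQ0 : 0 < Q := by linarith
  obtain ⟨A, hA⟩ : ∃ A, A = C * Q ^ (1 / 2 : ℝ) := ⟨_, rfl⟩
  have hA0 : 0 < A := hA ▸ by positivity
  rw [← hA]
  let Φ : Euc d → Fin d → ℝ := fun y j => dist y (x j)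
  have hexp := volume_le_of_expanding E Φ (K * C).toNNReal fun y hy y' hy' => by
    rw [Real.coe_toNNReal _ (by positivity)]
    exact dist_le_of_det_bound hK x (by linarith)
      (hdet _ (hB.midpoint_mem (hEB hy) (hEB hy'))) (hEC y hy) (hEC y' hy')
  have hvolD : volume D ≤ ENNReal.ofReal (A * δ ^ (1 / 2 : ℝ)) := by
    have h1 : D ⊆ D ∩ closedBall 0 C := fun t ht =>
      ⟨ht, by simpa [abs_of_nonneg (hDC ht).1] using (hDC ht).2⟩
    refine (measure_mono h1).trans ((hD 0 C (by linarith)).trans (ENNReal.ofReal_le_ofReal ?_))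
    have h2 : (1 : ℝ) - 1 / 2 = 1 / 2 := by norm_num
    rw [h2, hA, mul_right_comm]
    gcongr
  have hvolM : ∀ a, volume (D ∩ closedBall a (Q * ρ)) ≤
      ENNReal.ofReal (A * δ ^ (1 / 2 : ℝ) * ρ ^ (1 / 2 : ℝ)) := fun a => by
    refine (hD a (Q * ρ) (by nlinarith)).trans (ENNReal.ofReal_le_ofReal (le_of_eq ?_))
    have h2 : (1 : ℝ) - 1 / 2 = 1 / 2 := by norm_num
    rw [h2, hA, Real.mul_rpow hQ0.le hρ0.le]
    ring
  have hcount := volume_le_of_controlled_coordinates (Φ '' E) D S hρ0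
    (by rintro _ ⟨y, hy, rfl⟩ i; exact hE y hy i)
    (by
      rintro _ ⟨y, hy, rfl⟩ _ ⟨y', hy', rfl⟩ h i
      exact (abs_dist_sub_le y y' (x i)).trans (hctrl y hy y' hy' h))
    hvolM
  have hSd : S.card + (d - S.card) = d := by omega
  calc volume E ≤ ((K * C).toNNReal : ℝ≥0∞) ^ d * (ENNReal.ofReal (A * δ ^ (1 / 2 : ℝ)) ^ S.card *
        ENNReal.ofReal (A * δ ^ (1 / 2 : ℝ) * ρ ^ (1 / 2 : ℝ)) ^ (d - S.card)) :=
        hexp.trans (by gcongr; exact hcount.trans (by gcongr))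
    _ = ENNReal.ofReal ((K * C) ^ d * ((A * δ ^ (1 / 2 : ℝ)) ^ S.card *
        (A * δ ^ (1 / 2 : ℝ) * ρ ^ (1 / 2 : ℝ)) ^ (d - S.card))) := by
        rw [ENNReal.ofReal_mul (p := (K * C) ^ d) (by positivity),
          ENNReal.ofReal_pow (p := K * C) (by positivity),
          ENNReal.ofReal_mul (p := (A * δ ^ (1 / 2 : ℝ)) ^ S.card) (by positivity),
          ENNReal.ofReal_pow (p := A * δ ^ (1 / 2 : ℝ)) (by positivity),
          ENNReal.ofReal_pow (p := A * δ ^ (1 / 2 : ℝ) * ρ ^ (1 / 2 : ℝ)) (by positivity)]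
        rfl
    _ ≤ _ := by
        refine ENNReal.ofReal_le_ofReal ?_
        rw [mul_assoc ((K * C) ^ d)]
        refine mul_le_mul_of_nonneg_left ?_ (by positivity)
        have h1 : (A * δ ^ (1 / 2 : ℝ)) ^ S.card *
            (A * δ ^ (1 / 2 : ℝ) * ρ ^ (1 / 2 : ℝ)) ^ (d - S.card)
            = A ^ d * ((δ ^ (1 / 2 : ℝ)) ^ d * (ρ ^ (1 / 2 : ℝ)) ^ (d - S.card)) := by
          rw [mul_pow _ (ρ ^ (1 / 2 : ℝ)), ← mul_assoc, ← pow_add, hSd, mul_pow, mul_assoc]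
        have h2 : (δ ^ (1 / 2 : ℝ)) ^ d = δ ^ ((d : ℝ) / 2) := by
          rw [← Real.rpow_natCast, ← Real.rpow_mul hδ.le]
          congr 1
          ring
        have h3 : (ρ ^ (1 / 2 : ℝ)) ^ k = ρ ^ ((k : ℝ) / 2) := by
          rw [← Real.rpow_natCast, ← Real.rpow_mul hρ0.le]
          congr 1
          ring
        rw [h1, h2, ← h3]
        have h4 : (ρ ^ (1 / 2 : ℝ)) ^ (d - S.card) ≤ (ρ ^ (1 / 2 : ℝ)) ^ k :=
          pow_le_pow_of_le_one (by positivity) (Real.rpow_le_one hρ0.le hρ (by norm_num))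
            (by omega)
        gcongr A ^ d * (_ * ?_)

/-- **Nondegeneracy, plate bound (Lemma 1.2 (i)).** In the pinned setup, the part of `F`
within distance `ρ` of a `(d-k)`-dimensional affine subspace has measure at most
`δ^(d/2 - Kε) · ρ^(k/2)`; in particular the `δ`-neighbourhood has measure at most
`δ^((k+d)/2 - Kε)`. -/
theorem pinned_plate_bound (d : ℕ) (hd : 2 ≤ d) (c C : ℝ) (hc : 0 < c) (hC : 1 ≤ C) :
    ∃ K : ℝ, 1 ≤ K ∧ ∃ ε₀ : ℝ, 0 < ε₀ ∧ ∀ ε : ℝ, 0 < ε → ε < ε₀ →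
      ∃ δ₀ : ℝ, 0 < δ₀ ∧ ∀ δ : ℝ, 0 < δ → δ < δ₀ →
      ∀ (b : Fin (d + 1) → Euc d) (D : Set ℝ) (x : Fin (d + 1) → Euc d) (F : Set (Euc d)),
        (∀ y : Fin (d + 1) → Euc d, (∀ j, y j ∈ closedBall (b j) 1) →
          c ≤ |Matrix.det (Matrix.of fun i j : Fin d => (y j.succ - y 0) i)| ∧
          |Matrix.det (Matrix.of fun i j : Fin d => (y j.succ - y 0) i)| ≤ C) →
        D ⊆ Icc 0 C →
        IsDeltaRhoSet1 δ (1 / 2) C D →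
        (∀ j : Fin (d + 1), j ≠ 0 → x j ∈ closedBall (b j) 1) →
        F ⊆ closedBall (b 0) 1 →
        MeasurableSet F →
        (∀ y ∈ F, ∀ j : Fin (d + 1), j ≠ 0 → dist y (x j) ∈ D) →
        ∀ k : ℕ, 1 ≤ k → k ≤ d →
        ∀ H : AffineSubspace ℝ (Euc d), (H : Set (Euc d)).Nonempty →
          Module.finrank ℝ H.direction = d - k →
        (∀ ρ : ℝ, δ ≤ ρ → ρ ≤ 1 →
          volume {y ∈ F | infDist y (H : Set (Euc d)) ≤ ρ}
            ≤ ENNReal.ofReal (δ ^ ((d : ℝ) / 2 - K * ε) * ρ ^ ((k : ℝ) / 2))) ∧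
        volume {y ∈ F | infDist y (H : Set (Euc d)) ≤ δ}
          ≤ ENNReal.ofReal (δ ^ (((k : ℝ) + d) / 2 - K * ε)) := by
  let K := max 1 (d * (d * (d.factorial * C ^ d / c)) : ℝ)
  have hK1 : 1 ≤ K := le_max_left _ _
  have hd0 : (0 : ℝ) < d := by exact_mod_cast (by omega : 0 < d)
  have hK : ∀ v : Fin d → Euc d, (∀ j, ‖v j‖ ≤ C) →
      c ≤ |Matrix.det (Matrix.of fun i j : Fin d => v j i)| →
      ∀ (h : Euc d) (s : ℝ), (∀ j, |inner ℝ (v j) h| ≤ s) → ‖h‖ ≤ K * s := by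
    intro v hv hdet h s hs
    have hs0 : 0 ≤ s := (abs_nonneg _).trans (hs ⟨0, by omega⟩)
    refine (norm_le_of_abs_inner_le hc hC v hv hdet h hs).trans ?_
    gcongr
    exact le_max_right _ _
  let r : ℝ := 1 / (2 * (K * d))
  have hr0 : 0 < r := by positivity
  have hr : K * d * r ≤ 1 / 2 := by
    simp only [r]
    field_simp
    rfl
  obtain ⟨t, -, htfin, htcover⟩ :=
    (isCompact_closedBall (0 : Euc d) 1).finite_cover_balls (half_pos hr0)
  lift t to Finset (Euc d) using htfin
  let P : ℝ := (K * C) ^ d * (C * (10 * K * d * C + 4) ^ (1 / 2 : ℝ)) ^ d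
  let Z : ℝ := max 1 (t.card * P)
  have hZ : 1 ≤ Z := le_max_left _ _
  refine ⟨1, le_rfl, 1, one_pos, fun ε hε _ => ⟨min 1 (Z ^ (-ε⁻¹)), by positivity,
    fun δ hδ hδlt b D x F hdet hDC hD hx hFb _ hFD k _ hkd H hH hHk => ?_⟩⟩
  have hδ1 : δ ≤ 1 := (hδlt.trans_le (min_le_left _ _)).le
  have hZδ : Z ≤ δ ^ (-ε) := by
    have h := Real.rpow_le_rpow_of_nonpos hδ (hδlt.trans_le (min_le_right _ _)).le
      (neg_nonpos.2 hε.le)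
    rwa [← Real.rpow_mul (by positivity), neg_mul_neg, inv_mul_cancel₀ hε.ne', Real.rpow_one] at h
  have hplate : ∀ ρ : ℝ, δ ≤ ρ → ρ ≤ 1 →
      volume {y ∈ F | infDist y (H : Set (Euc d)) ≤ ρ}
        ≤ ENNReal.ofReal (δ ^ ((d : ℝ) / 2 - 1 * ε) * ρ ^ ((k : ℝ) / 2)) := by
    intro ρ hδρ hρ
    have hρ0 : 0 < ρ := hδ.trans_le hδρ
    set E := {y ∈ F | infDist y (H : Set (Euc d)) ≤ ρ}
    have hpiece : ∀ p ∈ t, volume (E ∩ ball (b 0 + p) (r / 2)) ≤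
        ENNReal.ofReal (P * (δ ^ ((d : ℝ) / 2) * ρ ^ ((k : ℝ) / 2))) := by
      intro p _
      refine volume_plate_le_of_dist_le (by omega) hK1 hC hδ hδρ hρ hkd hK (fun j => x j.succ)
        (convex_closedBall (b 0) 1) (fun y hy => hFb hy.1.1) (fun m hm => ?_) hDC hD
        (fun y hy j => hFD y hy.1.1 _ (Fin.succ_ne_zero j)) hr (fun y hy y' hy' => ?_) H hH hHk
        (fun y hy => hy.1.2)
      · have h := (hdet (Fin.cons m fun j => x j.succ) fun j => ?_).1
        · simpa using h
        · refine Fin.cases ?_ (fun i => ?_) j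
          · simpa using hm
          · simpa using hx i.succ (Fin.succ_ne_zero i)
      · have h1 := mem_ball.1 hy.2
        have h2 := mem_ball.1 hy'.2
        have := dist_triangle_right y y' (b 0 + p)
        linarith
    have hcover : E ⊆ ⋃ p ∈ t, E ∩ ball (b 0 + p) (r / 2) := by
      intro y hy
      have h1 : y - b 0 ∈ closedBall (0 : Euc d) 1 := by
        simpa [dist_eq_norm] using hFb hy.1
      obtain ⟨p, hp, hyp⟩ := mem_iUnion₂.1 (htcover h1)
      refine mem_iUnion₂.2 ⟨p, hp, hy, ?_⟩
      rw [mem_ball, dist_eq_norm] at hyp ⊢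
      rwa [← sub_sub]
    calc volume E ≤ ∑ p ∈ t, volume (E ∩ ball (b 0 + p) (r / 2)) :=
          (measure_mono hcover).trans (measure_biUnion_finset_le _ _)
      _ ≤ ∑ _p ∈ t, ENNReal.ofReal (P * (δ ^ ((d : ℝ) / 2) * ρ ^ ((k : ℝ) / 2))) :=
          Finset.sum_le_sum hpiece
      _ = ENNReal.ofReal (t.card * P * (δ ^ ((d : ℝ) / 2) * ρ ^ ((k : ℝ) / 2))) := by
          rw [Finset.sum_const, nsmul_eq_mul, mul_assoc (t.card : ℝ),
            ENNReal.ofReal_mul (p := (t.card : ℝ)) (by positivity), ENNReal.ofReal_natCast]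
      _ ≤ _ := by
          refine ENNReal.ofReal_le_ofReal ?_
          have h : δ ^ ((d : ℝ) / 2 - 1 * ε) = δ ^ (-ε) * δ ^ ((d : ℝ) / 2) := by
            rw [← Real.rpow_add hδ]
            congr 1
            ring
          rw [h, mul_assoc (δ ^ (-ε))]
          gcongr
          exact (le_max_right _ _).trans hZδ
  refine ⟨hplate, (hplate δ le_rfl hδ1).trans_eq ?_⟩
  rw [← Real.rpow_add hδ]
  congr 2
  ring

end
end

section
/- Fix an integer d ≥ 2 and constants c > 0, C ≥ 1. There exist K ≥ 1 and ε_0 > 0 such that for every ε ∈ (0,ε_0) there exists δ_0 > 0 with the following property for all δ ∈ (0,δ_0). In the pinned setup, for every integer 1 ≤ k ≤ d, every affine subspace H ⊆ ℝ^d of dimension d−k, every point z ∈ ℝ^d, and every r ∈ [δ,1], one has vol({ y ∈ F : dist(y,H) ≤ δ and |y − z| ≤ r }) ≤ δ^{k + (d−k)/2 − Kε} · r^{(d−k)/2}. (That is, the δ-neighbourhood slice of F along H behaves like a (δ, (d−k)/2)_{d−k} set inside H.) -/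
open MeasureTheory Metric Set
open scoped ENNReal

noncomputable section

theorem exists_subfamily_abs_coeff_le_one {V ι : Type*} [AddCommGroup V] [Module ℝ V]
    [FiniteDimensional ℝ V] [Finite ι] (v : ι → V) (hv : Submodule.span ℝ (range v) = ⊤) :
    ∃ J : Fin (Module.finrank ℝ V) → ι, ∀ i, ∃ a : Fin (Module.finrank ℝ V) → ℝ,
      (∀ l, |a l| ≤ 1) ∧ v i = ∑ l, a l • v (J l) := by
  obtain ⟨J₀, hJ₀⟩ : ∃ J : Fin (Module.finrank ℝ V) → ι, LinearIndependent ℝ (v ∘ J) := by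
    obtain ⟨f, hf, -, hli⟩ := Submodule.exists_fun_fin_finrank_span_eq ℝ (range v)
    have hcard : Module.finrank ℝ (Submodule.span ℝ (range v)) = Module.finrank ℝ V := by
      rw [hv, finrank_top]
    choose g hg using hf
    refine ⟨g ∘ Fin.cast hcard.symm, ?_⟩
    have : v ∘ g ∘ Fin.cast hcard.symm = f ∘ Fin.cast hcard.symm := by
      funext i; simp [hg]
    rw [this]
    exact hli.comp _ (Fin.cast_injective _)
  set b := Module.finBasis ℝ V
  have : Nonempty (Fin (Module.finrank ℝ V) → ι) := ⟨J₀⟩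
  obtain ⟨J, hJ⟩ := Finite.exists_max fun J : Fin (Module.finrank ℝ V) → ι => |b.det (v ∘ J)|
  have hdet₀ : b.det (v ∘ J₀) ≠ 0 := by
    have := (b.is_basis_iff_det (v := v ∘ J₀)).1
      ⟨hJ₀, hJ₀.span_eq_top_of_card_eq_finrank' (by simp)⟩
    exact this.ne_zero
  have hpos : 0 < |b.det (v ∘ J)| := (abs_pos.2 hdet₀).trans_le (hJ J₀)
  obtain ⟨hli, hsp⟩ := (b.is_basis_iff_det (v := v ∘ J)).2 (abs_pos.1 hpos).isUnit
  set e := Module.Basis.mk hli hsp.ge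
  refine ⟨J, fun i => ⟨fun l => e.repr (v i) l, fun l => ?_, ?_⟩⟩
  · have h1 := congrArg (fun f => f (v i)) (b.det_smul_mk_coord_eq_det_update hli hsp.ge l)
    have h2 : b.det (v ∘ J) * e.repr (v i) l = b.det (Function.update (v ∘ J) l (v i)) := h1
    rw [← Function.comp_update] at h2
    have h3 := hJ (Function.update J l i)
    rw [← h2, abs_mul] at h3
    exact le_of_mul_le_mul_left (by simpa using h3) hpos
  · have he : ∀ l, e l = v (J l) := fun l => Module.Basis.mk_apply hli hsp.ge l
    simpa only [he] using (e.sum_repr (v i)).symm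

open scoped InnerProductSpace in
theorem exists_norm_le_of_abs_inner_le (d : ℕ) {c C : ℝ} (hc : 0 < c) (hC : 1 ≤ C) :
    ∃ A : ℝ, 0 < A ∧ ∀ v : Fin d → Euc d, (∀ j, ‖v j‖ ≤ C) →
      c ≤ |Matrix.det (Matrix.of fun i j : Fin d => v j i)| →
      ∀ (w : Euc d) (B : ℝ), 0 ≤ B → (∀ j, |⟪v j, w⟫_ℝ| ≤ B) → ‖w‖ ≤ A * B := by
  set G : ℝ := d.factorial * C ^ d with hG
  have hG0 : 0 < G := by positivity
  refine ⟨(d * (d * G) + 1) / c, by positivity, fun v hv hdet w B hB hw => ?_⟩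
  set M : Matrix (Fin d) (Fin d) ℝ := Matrix.of fun i j => v i j
  have hM : c ≤ |M.det| := by rwa [← Matrix.det_transpose]
  have hMw : ∀ j, (M.mulVec w.ofLp) j = ⟪v j, w⟫_ℝ := fun j => by
    simp [Matrix.mulVec, dotProduct, PiLp.inner_apply, M, mul_comm]
  have hadj : ∀ i j, |M.adjugate i j| ≤ G := fun i j => by
    rw [Matrix.adjugate_apply]
    have := Matrix.det_le (A := M.updateRow j (Pi.single i 1)) (abv := AbsoluteValue.abs) (x := C)
      (fun a b => by
        by_cases h : a = j
        · subst h
          by_cases h' : b = i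
          · subst h'; simpa
          · simpa [h'] using zero_le_one.trans hC
        · simpa [h, M] using ((EuclideanSpace.norm_eq (v a) ▸ PiLp.norm_apply_le (v a) b).trans
            (EuclideanSpace.norm_eq (v a) ▸ hv a)))
    simpa [hG] using this
  have hcoord : ∀ i, c * |w i| ≤ d * G * B := fun i => by
    have h1 : M.det * w i = ∑ j, M.adjugate i j * ⟪v j, w⟫_ℝ := by
      have : M.adjugate.mulVec (M.mulVec w.ofLp) = M.det • w.ofLp := by
        rw [Matrix.mulVec_mulVec, Matrix.adjugate_mul, Matrix.smul_mulVec, Matrix.one_mulVec]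
      have := congrFun this i
      rw [Pi.smul_apply, smul_eq_mul] at this
      simp only [← this, ← hMw]
      rfl
    calc c * |w i| ≤ |M.det| * |w i| := by gcongr
      _ = |∑ j, M.adjugate i j * ⟪v j, w⟫_ℝ| := by rw [← abs_mul, h1]
      _ ≤ ∑ j, |M.adjugate i j * ⟪v j, w⟫_ℝ| := Finset.abs_sum_le_sum_abs _ _
      _ ≤ ∑ _j : Fin d, G * B := Finset.sum_le_sum fun j _ => by
          rw [abs_mul]
          exact mul_le_mul (hadj i j) (hw j) (abs_nonneg _) hG0.le
      _ = d * G * B := by simp; ring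
  have hnorm : ‖w‖ ≤ ∑ i, |w i| := by
    have := (EuclideanSpace.basisFun (Fin d) ℝ).sum_repr w
    calc ‖w‖ = ‖∑ i, w i • EuclideanSpace.basisFun (Fin d) ℝ i‖ := by
          conv_lhs => rw [← this]
          rfl
      _ ≤ ∑ i, ‖w i • EuclideanSpace.basisFun (Fin d) ℝ i‖ := norm_sum_le _ _
      _ = _ := by simp [norm_smul]
  rw [div_mul_eq_mul_div, le_div_iff₀ hc]
  calc ‖w‖ * c ≤ (∑ i, |w i|) * c := by gcongr
    _ = ∑ i, c * |w i| := by rw [Finset.sum_mul]; simp [mul_comm]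
    _ ≤ ∑ _i : Fin d, d * G * B := Finset.sum_le_sum fun i _ => hcoord i
    _ = d * (d * G) * B := by simp; ring
    _ ≤ (d * (d * G) + 1) * B := by gcongr; linarith

open scoped InnerProductSpace in
theorem exists_subfamily_norm_le_of_abs_inner_le {d : ℕ} {v : Fin d → Euc d} {A : ℝ}
    (hv : ∀ (w : Euc d) (B : ℝ), 0 ≤ B → (∀ j, |⟪v j, w⟫_ℝ| ≤ B) → ‖w‖ ≤ A * B)
    (V : Submodule ℝ (Euc d)) :
    ∃ J : Fin (Module.finrank ℝ V) → Fin d, ∀ u ∈ V, ∀ B : ℝ, 0 ≤ B →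
      (∀ l, |⟪v (J l), u⟫_ℝ| ≤ B) → ‖u‖ ≤ A * (d * B) := by
  set p : Fin d → V := fun j => V.orthogonalProjectionOnto (v j)
  have hp : ∀ j (u : V), ⟪p j, u⟫_ℝ = ⟪v j, (u : Euc d)⟫_ℝ := fun j u => by
    simp [p]
  have hspan : Submodule.span ℝ (range p) = ⊤ := by
    rw [← Submodule.orthogonal_eq_bot_iff, Submodule.eq_bot_iff]
    intro u hu
    have : ‖(u : Euc d)‖ ≤ A * 0 := hv u 0 le_rfl fun j => by
      rw [← hp, Submodule.inner_right_of_mem_orthogonal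
        (Submodule.subset_span (mem_range_self j)) hu, abs_zero]
    simpa using this
  obtain ⟨J, hJ⟩ := exists_subfamily_abs_coeff_le_one p hspan
  refine ⟨J, fun u hu B hB h => hv u _ (by positivity) fun j => ?_⟩
  obtain ⟨a, ha, hsum⟩ := hJ j
  have h1 : ⟪v j, u⟫_ℝ = ∑ l, a l * ⟪v (J l), u⟫_ℝ := by
    rw [← hp j ⟨u, hu⟩, hsum, sum_inner]
    exact Finset.sum_congr rfl fun l _ => by rw [real_inner_smul_left, hp]
  have hfin : (Module.finrank ℝ V : ℝ) ≤ d := by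
    have := V.finrank_le
    rw [finrank_euclideanSpace_fin] at this
    exact_mod_cast this
  calc |⟪v j, u⟫_ℝ| ≤ ∑ l, |a l * ⟪v (J l), u⟫_ℝ| := h1 ▸ Finset.abs_sum_le_sum_abs _ _
    _ ≤ ∑ _l : Fin (Module.finrank ℝ V), B := Finset.sum_le_sum fun l _ => by
        rw [abs_mul]
        exact (mul_le_of_le_one_left (abs_nonneg _) (ha l)).trans (h l)
    _ = Module.finrank ℝ V * B := by simp
    _ ≤ d * B := by gcongr

/-- A map expanding distances up to a factor `L` decreases volume by at most `L ^ n`. -/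
theorem volume_le_of_dist_le_mul_dist {d : ℕ} {ι : Type*} [Fintype ι] (hι : Fintype.card ι = d)
    {S : Set (Euc d)} {Φ : Euc d → ι → ℝ} {L : ℝ} (hL : 0 ≤ L)
    (h : ∀ y ∈ S, ∀ y' ∈ S, dist y y' ≤ L * dist (Φ y) (Φ y')) :
    volume S ≤ ENNReal.ofReal (L ^ d) * volume (Φ '' S) := by
  set e : Euc d → (Fin d → ℝ) := WithLp.ofLp
  set g : (ι → ℝ) → Euc d := Function.invFunOn Φ S
  have hinj : InjOn Φ S := fun y hy y' hy' heq => by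
    simpa [heq] using h y hy y' hy'
  have hg : ∀ y ∈ S, g (Φ y) = y := fun y hy => hinj.leftInvOn_invFunOn hy
  have hlip : LipschitzOnWith L.toNNReal (e ∘ g) (Φ '' S) := by
    refine LipschitzOnWith.of_dist_le_mul ?_
    rintro _ ⟨y, hy, rfl⟩ _ ⟨y', hy', rfl⟩
    simp only [Function.comp, hg y hy, hg y' hy', Real.coe_toNNReal _ hL]
    refine le_trans ?_ (h y hy y' hy')
    simpa using (PiLp.lipschitzWith_ofLp 2 (fun _ : Fin d => ℝ)).dist_le_mul y y'
  have himg : (e ∘ g) '' (Φ '' S) = e '' S := by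
    rw [image_image]
    exact image_congr fun y hy => by simp [hg y hy]
  have hvol : volume (e '' S) = volume S := by
    have := (EuclideanSpace.volume_preserving_symm_measurableEquiv_toLp (Fin d)).symm
    have h2 := this.measure_preimage_equiv S
    rw [← h2]
    congr 1
    ext y
    constructor
    · rintro ⟨z, hz, rfl⟩; exact hz
    · intro hy; exact ⟨_, hy, rfl⟩
  have := hlip.hausdorffMeasure_image_le (d := d) (by positivity)
  rw [himg] at this
  have h1 : (μH[(d : ℝ)] : Measure (Fin d → ℝ)) = volume := by
    simpa using hausdorffMeasure_pi_real (ι := Fin d)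
  have h2 : (μH[(d : ℝ)] : Measure (ι → ℝ)) = volume := by
    rw [← hι]; exact hausdorffMeasure_pi_real
  rw [h1, h2, hvol] at this
  rwa [ENNReal.ofReal_pow hL, ← ENNReal.rpow_natCast]

theorem norm_le_sum_abs_inner {E ι : Type*} [NormedAddCommGroup E] [InnerProductSpace ℝ E]
    [Fintype ι] (b : OrthonormalBasis ι ℝ E) (w : E) : ‖w‖ ≤ ∑ i, |inner ℝ (b i) w| := by
  calc ‖w‖ = ‖∑ i, inner ℝ (b i) w • b i‖ := by rw [b.sum_repr']
    _ ≤ ∑ i, ‖inner ℝ (b i) w • b i‖ := norm_sum_le _ _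
    _ = _ := by simp [norm_smul]

open scoped InnerProductSpace in
theorem abs_inner_sub_le_of_abs_dist_sub_le {E : Type*} [NormedAddCommGroup E]
    [InnerProductSpace ℝ E] {x y y' y₀ : E} {C s ρ : ℝ}
    (hy : dist y x ≤ C) (hy' : dist y' x ≤ C) (hyρ : dist y y₀ ≤ ρ) (hyρ' : dist y' y₀ ≤ ρ)
    (hs : |dist y x - dist y' x| ≤ s) :
    |⟪x - y₀, y - y'⟫_ℝ| ≤ C * s + ρ * ‖y - y'‖ := by
  rw [dist_eq_norm] at hy hy' hyρ hyρ'
  rw [dist_eq_norm, dist_eq_norm] at hs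
  have h1 : ⟪x - y₀, y - y'⟫_ℝ =
      (⟪(y - y₀) + (y' - y₀), y - y'⟫_ℝ - (‖y - x‖ - ‖y' - x‖) * (‖y - x‖ + ‖y' - x‖)) / 2 := by
    have h2 : (‖y - x‖ - ‖y' - x‖) * (‖y - x‖ + ‖y' - x‖) =
        ⟪y - x, y - x⟫_ℝ - ⟪y' - x, y' - x⟫_ℝ := by
      rw [real_inner_self_eq_norm_sq, real_inner_self_eq_norm_sq]; ring
    rw [h2]
    simp only [inner_sub_left, inner_sub_right, inner_add_left]
    rw [real_inner_comm x y, real_inner_comm x y', real_inner_comm y y']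
    ring
  have h3 : |⟪(y - y₀) + (y' - y₀), y - y'⟫_ℝ| ≤ 2 * ρ * ‖y - y'‖ :=
    (abs_real_inner_le_norm _ _).trans <| by
      gcongr
      linarith [norm_add_le (y - y₀) (y' - y₀)]
  have h4 : |(‖y - x‖ - ‖y' - x‖) * (‖y - x‖ + ‖y' - x‖)| ≤ s * (2 * C) := by
    rw [abs_mul]
    refine mul_le_mul hs ?_ (abs_nonneg _) ((abs_nonneg _).trans hs)
    rw [abs_of_nonneg (by positivity)]
    linarith
  rw [h1, abs_div, abs_two, div_le_iff₀ two_pos]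
  linarith [abs_sub (⟪(y - y₀) + (y' - y₀), y - y'⟫_ℝ)
    ((‖y - x‖ - ‖y' - x‖) * (‖y - x‖ + ‖y' - x‖))]

open scoped InnerProductSpace in
/-- The slice bound for a set of small diameter. -/
theorem volume_slice_le_of_dist_le {d : ℕ} {C A δ r ρ : ℝ} (hC : 1 ≤ C) (hA : 0 < A) (hδ : 0 < δ)
    {D : Set ℝ} (hD : D ⊆ Icc 0 C) (hDδ : IsDeltaRhoSet1 δ (1 / 2) C D) {x : Fin d → Euc d}
    {S : Set (Euc d)} (hSD : ∀ y ∈ S, ∀ j, dist y (x j) ∈ D) {y₀ : Euc d} (hy₀ : y₀ ∈ S)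
    (hx : ∀ (w : Euc d) (B : ℝ), 0 ≤ B → (∀ j, |⟪x j - y₀, w⟫_ℝ| ≤ B) → ‖w‖ ≤ A * B)
    (hρ : A * d * ρ ≤ 1 / 2) (hSρ : ∀ y ∈ S, dist y y₀ ≤ ρ) {z : Euc d} (hr : δ ≤ r)
    (hSr : ∀ y ∈ S, dist y z ≤ r) {V : Submodule ℝ (Euc d)} {p : Euc d}
    (hSV : ∀ y ∈ S, ∃ q, q - p ∈ V ∧ dist y q ≤ 2 * δ) :
    volume S ≤ ENNReal.ofReal ((2 * (d + A * (d * (C + C * d)))) ^ d *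
      ((4 * δ) ^ (d - Module.finrank ℝ V) *
        (C * δ ^ (1 / 2 : ℝ) * r ^ (1 / 2 : ℝ)) ^ Module.finrank ℝ V)) := by
  set L : ℝ := 2 * (d + A * (d * (C + C * d)))
  have hr0 : 0 < r := hδ.trans_le hr
  have hρ0 : 0 ≤ ρ := dist_nonneg.trans (hSρ y₀ hy₀)
  obtain ⟨J, hJ⟩ := exists_subfamily_norm_le_of_abs_inner_le hx V
  have hrank : Module.finrank ℝ V + Module.finrank ℝ Vᗮ = d := by
    rw [V.finrank_add_finrank_orthogonal, finrank_euclideanSpace_fin]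
  set n := stdOrthonormalBasis ℝ Vᗮ
  set Φ : Euc d → Fin (Module.finrank ℝ Vᗮ) ⊕ Fin (Module.finrank ℝ V) → ℝ := fun y =>
    Sum.elim (fun i => ⟪(n i : Euc d), y⟫_ℝ) (fun l => dist y (x (J l)))
  have hexp : ∀ y ∈ S, ∀ y' ∈ S, dist y y' ≤ L * dist (Φ y) (Φ y') := by
    intro y hy y' hy'
    set s := dist (Φ y) (Φ y')
    have hs0 : 0 ≤ s := dist_nonneg
    set w := y - y' with hw
    have hsn : ∀ i, |⟪(n i : Euc d), w⟫_ℝ| ≤ s := fun i => by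
      rw [hw, inner_sub_right]
      exact dist_le_pi_dist (Φ y) (Φ y') (Sum.inl i)
    have hsd : ∀ l, |dist y (x (J l)) - dist y' (x (J l))| ≤ s := fun l =>
      dist_le_pi_dist (Φ y) (Φ y') (Sum.inr l)
    set u := V.starProjection w
    set m : Vᗮ := ⟨w - u, V.sub_starProjection_mem_orthogonal w⟩
    have hu : u ∈ V := V.starProjection_apply_mem w
    have hm : ‖w - u‖ ≤ d * s := by
      calc ‖m‖ ≤ ∑ i, |⟪n i, m⟫_ℝ| := norm_le_sum_abs_inner n m
        _ ≤ ∑ _i : Fin (Module.finrank ℝ Vᗮ), s := Finset.sum_le_sum fun i _ => by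
            have h1 : ⟪n i, m⟫_ℝ = ⟪(n i : Euc d), w⟫_ℝ := by
              rw [Submodule.coe_inner, inner_sub_right,
                Submodule.inner_left_of_mem_orthogonal hu (n i).2, sub_zero]
            rw [h1]
            exact hsn i
        _ = Module.finrank ℝ Vᗮ * s := by simp
        _ ≤ d * s := by
            gcongr
            omega
    have hun : ‖u‖ ≤ A * (d * (C * s + ρ * ‖w‖ + C * (d * s))) := by
      refine hJ u hu _ (by positivity) fun l => ?_
      have h1 : ⟪x (J l) - y₀, u⟫_ℝ = ⟪x (J l) - y₀, w⟫_ℝ - ⟪x (J l) - y₀, w - u⟫_ℝ := by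
        rw [← inner_sub_right, sub_sub_cancel]
      have h2 := abs_inner_sub_le_of_abs_dist_sub_le
        (hD (hSD y hy (J l))).2 (hD (hSD y' hy' (J l))).2 (hSρ y hy) (hSρ y' hy') (hsd l)
      have h3 : |⟪x (J l) - y₀, w - u⟫_ℝ| ≤ C * (d * s) := by
        refine (abs_real_inner_le_norm _ _).trans ?_
        rw [← dist_eq_norm, dist_comm]
        exact mul_le_mul (hD (hSD y₀ hy₀ (J l))).2 hm (norm_nonneg _) (by positivity)
      rw [h1]
      exact (abs_sub _ _).trans (add_le_add h2 h3)
    have hwn : ‖w‖ ≤ ‖w - u‖ + ‖u‖ := by simpa using norm_add_le (w - u) u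
    have h5 : A * d * ρ * ‖w‖ ≤ 1 / 2 * ‖w‖ := by gcongr
    rw [dist_eq_norm, ← hw]
    simp only [L]
    nlinarith
  have himg : Φ '' S ⊆ univ.pi (Sum.elim (fun i => closedBall ⟪(n i : Euc d), p⟫_ℝ (2 * δ))
      (fun l => D ∩ closedBall (dist z (x (J l))) r)) := by
    rintro _ ⟨y, hy, rfl⟩ (i | l) -
    · obtain ⟨q, hq, hyq⟩ := hSV y hy
      have h1 : ⟪(n i : Euc d), y⟫_ℝ - ⟪(n i : Euc d), p⟫_ℝ = ⟪(n i : Euc d), y - q⟫_ℝ := by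
        have := Submodule.inner_left_of_mem_orthogonal hq (n i).2
        rw [inner_sub_right] at this ⊢
        linarith
      have h2 : ‖(n i : Euc d)‖ = 1 := n.orthonormal.1 i
      have := abs_real_inner_le_norm (n i : Euc d) (y - q)
      rw [h2, one_mul, ← dist_eq_norm, ← h1] at this
      exact this.trans hyq
    · refine ⟨hSD y hy _, ?_⟩
      rw [mem_closedBall, Real.dist_eq]
      exact (abs_dist_sub_le y z (x (J l))).trans (hSr y hy)
  have hbox : volume (Φ '' S) ≤ ENNReal.ofReal ((4 * δ) ^ (d - Module.finrank ℝ V) *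
        (C * δ ^ (1 / 2 : ℝ) * r ^ (1 / 2 : ℝ)) ^ Module.finrank ℝ V) := by
    refine (measure_mono himg).trans ?_
    rw [volume_pi_pi, Fintype.prod_sum_type, ENNReal.ofReal_mul (by positivity)]
    refine mul_le_mul' ?_ ?_
    · have h1 : d - Module.finrank ℝ V = Module.finrank ℝ Vᗮ := by omega
      simp only [Sum.elim_inl, Real.volume_closedBall, Finset.prod_const, Finset.card_univ,
        Fintype.card_fin]
      rw [h1, ENNReal.ofReal_pow (by positivity), ← mul_assoc]
      norm_num
    · rw [ENNReal.ofReal_pow (by positivity)]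
      calc _ ≤ ∏ _l : Fin (Module.finrank ℝ V),
            ENNReal.ofReal (C * δ ^ (1 / 2 : ℝ) * r ^ (1 / 2 : ℝ)) :=
          Finset.prod_le_prod' fun l _ => by
            have := hDδ (dist z (x (J l))) r hr
            norm_num at this ⊢
            exact this
        _ = _ := by simp
  have hL : 0 ≤ L := by positivity
  calc volume S ≤ ENNReal.ofReal (L ^ d) * volume (Φ '' S) :=
        volume_le_of_dist_le_mul_dist (by simp; omega) hL hexp
    _ ≤ _ := by
        rw [ENNReal.ofReal_mul (by positivity)]
        gcongr

/-- **Nondegeneracy, slice bound (Remark 1.3).** In the pinned setup, the `δ`-neighbourhood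
slice of `F` along a `(d-k)`-dimensional affine subspace `H` behaves like a
`(δ,(d-k)/2)_{d-k}` set inside `H`: its intersection with any ball of radius `r ∈ [δ,1]`
has measure at most `δ^(k + (d-k)/2 - Kε) · r^((d-k)/2)`. -/
theorem pinned_slice_drho_bound (d : ℕ) (hd : 2 ≤ d) (c C : ℝ) (hc : 0 < c) (hC : 1 ≤ C) :
    ∃ K : ℝ, 1 ≤ K ∧ ∃ ε₀ : ℝ, 0 < ε₀ ∧ ∀ ε : ℝ, 0 < ε → ε < ε₀ →
      ∃ δ₀ : ℝ, 0 < δ₀ ∧ ∀ δ : ℝ, 0 < δ → δ < δ₀ →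
      ∀ (b : Fin (d + 1) → Euc d) (D : Set ℝ) (x : Fin (d + 1) → Euc d) (F : Set (Euc d)),
        (∀ y : Fin (d + 1) → Euc d, (∀ j, y j ∈ closedBall (b j) 1) →
          c ≤ |Matrix.det (Matrix.of fun i j : Fin d => (y j.succ - y 0) i)| ∧
          |Matrix.det (Matrix.of fun i j : Fin d => (y j.succ - y 0) i)| ≤ C) →
        D ⊆ Icc 0 C →
        IsDeltaRhoSet1 δ (1 / 2) C D →
        (∀ j : Fin (d + 1), j ≠ 0 → x j ∈ closedBall (b j) 1) →
        F ⊆ closedBall (b 0) 1 →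
        MeasurableSet F →
        (∀ y ∈ F, ∀ j : Fin (d + 1), j ≠ 0 → dist y (x j) ∈ D) →
        ∀ k : ℕ, 1 ≤ k → k ≤ d →
        ∀ H : AffineSubspace ℝ (Euc d), (H : Set (Euc d)).Nonempty →
          Module.finrank ℝ H.direction = d - k →
        ∀ z : Euc d, ∀ r : ℝ, δ ≤ r → r ≤ 1 →
          volume {y ∈ F | infDist y (H : Set (Euc d)) ≤ δ ∧ dist y z ≤ r}
            ≤ ENNReal.ofReal
                (δ ^ ((k : ℝ) + ((d : ℝ) - k) / 2 - K * ε) * r ^ (((d : ℝ) - k) / 2)) := by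
  obtain ⟨A, hA, hAv⟩ := exists_norm_le_of_abs_inner_le d hc hC
  have hC0 : 0 < C := one_pos.trans_le hC
  have hd0 : (0 : ℝ) < d := by exact_mod_cast (by omega : 0 < d)
  set ρ : ℝ := 1 / (2 * (A * d)) with hρ
  have hρ0 : 0 < ρ := by positivity
  obtain ⟨T, -, hTfin, hT⟩ :=
    (isCompact_closedBall (0 : Euc d) 1).finite_cover_balls (half_pos hρ0)
  lift T to Finset (Euc d) using hTfin
  set L : ℝ := 2 * (d + A * (d * (C + C * d)))
  have hL : 0 ≤ L := by positivity
  set M : ℝ := T.card * L ^ d * (4 * C) ^ d + 1 with hM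
  have hM0 : 0 < M := by positivity
  refine ⟨1, le_rfl, 1, one_pos, fun ε hε _ => ⟨M ^ (-1 / ε), by positivity, ?_⟩⟩
  intro δ hδ hδM b D x F hdet hD hDδ hx hFb _ hFD k hk hkd H ⟨p, hp⟩ hH z r hr hr1
  have hr0 : 0 < r := hδ.trans_le hr
  have hMδ : M ≤ δ ^ (-ε) := by
    calc M = (M ^ (-1 / ε)) ^ (-ε) := by
          rw [← Real.rpow_mul hM0.le]
          have : -1 / ε * -ε = 1 := by field_simp
          rw [this, Real.rpow_one]
      _ ≤ δ ^ (-ε) := Real.rpow_le_rpow_of_nonpos hδ hδM.le (by linarith)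
  set S : Set (Euc d) := {y ∈ F | infDist y (H : Set (Euc d)) ≤ δ ∧ dist y z ≤ r}
  set Q : ℝ := L ^ d * ((4 * δ) ^ (d - (d - k)) *
    (C * δ ^ (1 / 2 : ℝ) * r ^ (1 / 2 : ℝ)) ^ (d - k)) with hQ
  have hpiece : ∀ t ∈ T, volume (S ∩ ball (b 0 + t) (ρ / 2)) ≤ ENNReal.ofReal Q := by
    intro t _
    rcases (S ∩ ball (b 0 + t) (ρ / 2)).eq_empty_or_nonempty with h | ⟨y₀, hy₀⟩
    · simp [h]
    have hy₀F : y₀ ∈ F := hy₀.1.1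
    have hdety := (hdet (Function.update x 0 y₀) fun j => by
      by_cases hj : j = 0
      · subst hj; simpa using hFb hy₀F
      · simpa [hj] using hx j hj).1
    simp only [Function.update_self, Function.update_of_ne (Fin.succ_ne_zero _)] at hdety
    have hv := hAv (fun j => x j.succ - y₀) (fun j => by
      rw [← dist_eq_norm, dist_comm]
      exact (hD (hFD y₀ hy₀F _ (Fin.succ_ne_zero j))).2) hdety
    rw [hQ, ← hH]
    refine volume_slice_le_of_dist_le hC hA hδ hD hDδ (ρ := ρ) (z := z) (p := p)
      (fun y hy j => hFD y hy.1.1 j.succ (Fin.succ_ne_zero j)) hy₀ hv ?_ ?_ hr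
      (fun y hy => hy.1.2.2) ?_
    · rw [hρ]
      exact le_of_eq (by field_simp)
    · intro y hy
      linarith [dist_triangle_right y y₀ (b 0 + t), mem_ball.1 hy.2, mem_ball.1 hy₀.2]
    · intro y hy
      obtain ⟨q, hq, hyq⟩ := (infDist_lt_iff ⟨p, hp⟩).1
        (hy.1.2.1.trans_lt (by linarith : δ < 2 * δ))
      exact ⟨q, AffineSubspace.vsub_mem_direction hq hp, hyq.le⟩
  have hcover : S ⊆ ⋃ t ∈ T, S ∩ ball (b 0 + t) (ρ / 2) := by
    intro y hy
    have h1 : y - b 0 ∈ closedBall (0 : Euc d) 1 := by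
      simpa [dist_eq_norm] using hFb hy.1
    obtain ⟨t, ht, hyt⟩ := mem_iUnion₂.1 (hT h1)
    refine mem_iUnion₂.2 ⟨t, ht, hy, ?_⟩
    rw [mem_ball, dist_eq_norm] at hyt ⊢
    rwa [← sub_sub]
  have hexp : (δ ^ (1 / 2 : ℝ)) ^ (d - k) = δ ^ (((d : ℝ) - k) / 2) := by
    rw [← Real.rpow_natCast, ← Real.rpow_mul hδ.le, Nat.cast_sub hkd]
    congr 1
    ring
  have hexr : (r ^ (1 / 2 : ℝ)) ^ (d - k) = r ^ (((d : ℝ) - k) / 2) := by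
    rw [← Real.rpow_natCast, ← Real.rpow_mul hr0.le, Nat.cast_sub hkd]
    congr 1
    ring
  have hconst : (4 : ℝ) ^ k * C ^ (d - k) ≤ (4 * C) ^ d := by
    rw [mul_pow]
    gcongr
    · norm_num
    · omega
  calc volume S ≤ ∑ t ∈ T, volume (S ∩ ball (b 0 + t) (ρ / 2)) :=
        (measure_mono hcover).trans (measure_biUnion_finset_le _ _)
    _ ≤ ∑ _t ∈ T, ENNReal.ofReal Q := Finset.sum_le_sum hpiece
    _ = ENNReal.ofReal (T.card * Q) := by
        rw [Finset.sum_const, nsmul_eq_mul, ENNReal.ofReal_mul (Nat.cast_nonneg _),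
          ENNReal.ofReal_natCast]
    _ ≤ _ := by
        refine ENNReal.ofReal_le_ofReal ?_
        calc T.card * Q = T.card * L ^ d * ((4 : ℝ) ^ k * C ^ (d - k)) *
              (δ ^ k * δ ^ (((d : ℝ) - k) / 2) * r ^ (((d : ℝ) - k) / 2)) := by
              rw [hQ, Nat.sub_sub_self hkd, mul_pow 4, mul_pow (C * _), mul_pow C, hexp, hexr]
              ring
          _ ≤ T.card * L ^ d * (4 * C) ^ d *
              (δ ^ k * δ ^ (((d : ℝ) - k) / 2) * r ^ (((d : ℝ) - k) / 2)) := by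
              gcongr
          _ ≤ δ ^ (-ε) * (δ ^ k * δ ^ (((d : ℝ) - k) / 2) * r ^ (((d : ℝ) - k) / 2)) := by
              gcongr
              linarith
          _ = _ := by
              rw [← Real.rpow_natCast δ k, ← Real.rpow_add hδ, ← mul_assoc, ← Real.rpow_add hδ]
              congr 2
              ring

end
end

section
/- Fix an integer d ≥ 2 and a constant C ≥ 1. There exist K ≥ 1 and ε_0 > 0 such that for every ε ∈ (0,ε_0) there exists δ_0 > 0 with the following property for all δ ∈ (0,δ_0). Let E ⊆ B(0,1) ⊆ ℝ^d be measurable with vol(E ∩ T) ≤ C·δ^{d−1/2−ε} for every δ-tube T, and suppose that vol({ (x_1,x_2) ∈ E × E : x_1 △ x_2 }) ≥ δ^{d+ε}, where x_1 △ x_2 means: |x_1−x_2| ≥ δ^{ε} and there exists a δ-tube T with x_1, x_2 ∈ T and vol(T ∩ E) ≥ δ^{d−1/2+ε}. Then there exists a finite, pairwise δ-separated family 𝒯 of δ-tubes such that #𝒯 ≥ δ^{1−d+Kε} and Σ_{T ∈ 𝒯} vol(T ∩ E) ≥ δ^{1/2+Kε}. -/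
open MeasureTheory Metric Set
open scoped ENNReal

noncomputable section

/-- The line through `a` with direction `v`. -/
def lineThrough {d : ℕ} (a v : Euc d) : Set (Euc d) :=
  Set.range fun t : ℝ => a + t • v

/-- The `ρ`-tube around the line through `a` with direction `v`: the closed
`ρ`-neighbourhood of the line. -/
def Tube {d : ℕ} (ρ : ℝ) (a v : Euc d) : Set (Euc d) :=
  {x | infDist x (lineThrough a v) ≤ ρ}

/-- Greedy selection: a finite family with property `P`, pairwise related by `r`, which either
has at least `N` members or is maximal. -/
theorem exists_finset_pairwise_card_or_maximal {α : Type*} (P : α → Prop) (r : α → α → Prop)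
    (hr : ∀ a b, r a b → r b a) (N : ℕ) :
    ∃ s : Finset α, (∀ a ∈ s, P a) ∧ (∀ a ∈ s, ∀ b ∈ s, a ≠ b → r a b) ∧
      (N ≤ s.card ∨ ∀ a, P a → a ∈ s ∨ ∃ b ∈ s, ¬ r a b) := by
  classical
  induction N with
  | zero => exact ⟨∅, by simp, by simp, Or.inl (Nat.zero_le _)⟩
  | succ N ih =>
    obtain ⟨s, hP, hs, hN | hmax⟩ := ih
    · by_cases hmax : ∀ a, P a → a ∈ s ∨ ∃ b ∈ s, ¬ r a b
      · exact ⟨s, hP, hs, Or.inr hmax⟩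
      · push Not at hmax
        obtain ⟨a, ha, has, hab⟩ := hmax
        refine ⟨insert a s, ?_, ?_, Or.inl ?_⟩
        · simpa [ha] using hP
        · intro x hx y hy hxy
          rcases Finset.mem_insert.1 hx with rfl | hxs <;>
            rcases Finset.mem_insert.1 hy with rfl | hys
          · exact absurd rfl hxy
          · exact hab y hys
          · exact hr _ _ (hab x hxs)
          · exact hs x hxs y hys hxy
        · rw [Finset.card_insert_of_notMem has]
          omega
    · exact ⟨s, hP, hs, Or.inr hmax⟩

/-- The `3ρ`-neighbourhood of a line is covered by boundedly many `ρ`-tubes parallel to it. -/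
theorem exists_finset_cover_by_tubes (d : ℕ) :
    ∃ F : Finset (Euc d), ∀ (ρ : ℝ), 0 < ρ → ∀ a v x y : Euc d, y ∈ lineThrough a v →
      dist x y ≤ 3 * ρ → ∃ w ∈ F, x ∈ Tube ρ (a + ρ • w) v := by
  obtain ⟨t, -, htf, ht⟩ :=
    (isCompact_closedBall (0 : Euc d) 3).finite_cover_balls (e := 1) one_pos
  refine ⟨htf.toFinset, fun ρ hρ a v x y hy hxy => ?_⟩
  have hmem : ρ⁻¹ • (x - y) ∈ closedBall (0 : Euc d) 3 := by
    rw [mem_closedBall_zero_iff, norm_smul, Real.norm_of_nonneg (inv_nonneg.2 hρ.le),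
      ← dist_eq_norm, inv_mul_le_iff₀ hρ]
    linarith
  obtain ⟨w, hw, hxw⟩ := mem_iUnion₂.1 (ht hmem)
  refine ⟨w, by simpa using hw, ?_⟩
  obtain ⟨s, rfl⟩ := hy
  have hline : a + s • v + ρ • w ∈ lineThrough (a + ρ • w) v :=
    ⟨s, by simp only; abel⟩
  refine (infDist_le_dist_of_mem hline).trans ?_
  have hsplit : x - (a + s • v + ρ • w) = ρ • (ρ⁻¹ • (x - (a + s • v)) - w) := by
    rw [smul_sub, smul_inv_smul₀ hρ.ne']
    abel
  rw [dist_eq_norm, hsplit, norm_smul, Real.norm_of_nonneg hρ.le]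
  rw [mem_ball, dist_eq_norm] at hxw
  nlinarith

/-- A point of the unit ball in a `ρ`-tube lies within `2ρ` of a point of the axis in the ball of
radius `2`. -/
theorem exists_dist_lt_of_mem_Tube {d : ℕ} {ρ : ℝ} (hρ : 0 < ρ) (hρ' : ρ ≤ 1 / 2)
    {a v x : Euc d} (hx : x ∈ closedBall (0 : Euc d) 1) (hxT : x ∈ Tube ρ a v) :
    ∃ y ∈ lineThrough a v ∩ closedBall (0 : Euc d) 2, dist x y < 2 * ρ := by
  have hxT' : infDist x (lineThrough a v) ≤ ρ := hxT
  obtain ⟨y, hy, hxy⟩ := (infDist_lt_iff (range_nonempty _)).1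
    (show infDist x (lineThrough a v) < 2 * ρ by linarith)
  refine ⟨y, ⟨hy, ?_⟩, hxy⟩
  rw [mem_closedBall] at hx ⊢
  linarith [dist_triangle y x 0, dist_comm x y]

/-- **Discretizing the family of lines (Lemma 2.1).** Tubes are encoded by pairs `(a,v)`
(point and direction) in the finite family `𝒯`. -/
theorem existence_of_tube_family (d : ℕ) (hd : 2 ≤ d) (C : ℝ) (hC : 1 ≤ C) :
    ∃ K : ℝ, 1 ≤ K ∧ ∃ ε₀ : ℝ, 0 < ε₀ ∧ ∀ ε : ℝ, 0 < ε → ε < ε₀ →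
      ∃ δ₀ : ℝ, 0 < δ₀ ∧ ∀ δ : ℝ, 0 < δ → δ < δ₀ →
      ∀ E : Set (Euc d),
        E ⊆ closedBall (0 : Euc d) 1 →
        MeasurableSet E →
        (∀ a v : Euc d, v ≠ 0 →
          volume (E ∩ Tube δ a v) ≤ ENNReal.ofReal (C * δ ^ ((d : ℝ) - 1 / 2 - ε))) →
        ENNReal.ofReal (δ ^ ((d : ℝ) + ε)) ≤
          volume {p : Euc d × Euc d | p.1 ∈ E ∧ p.2 ∈ E ∧
            δ ^ ε ≤ dist p.1 p.2 ∧
            ∃ a v : Euc d, v ≠ 0 ∧ p.1 ∈ Tube δ a v ∧ p.2 ∈ Tube δ a v ∧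
              ENNReal.ofReal (δ ^ ((d : ℝ) - 1 / 2 + ε)) ≤ volume (Tube δ a v ∩ E)} →
        ∃ 𝒯 : Finset (Euc d × Euc d),
          (∀ p ∈ 𝒯, p.2 ≠ 0) ∧
          -- pairwise δ-separated tubes
          (∀ p ∈ 𝒯, ∀ q ∈ 𝒯, p ≠ q →
            δ ≤ hausdorffDist (lineThrough p.1 p.2 ∩ closedBall (0 : Euc d) 2)
                  (lineThrough q.1 q.2 ∩ closedBall (0 : Euc d) 2)) ∧
          δ ^ (1 - (d : ℝ) + K * ε) ≤ (𝒯.card : ℝ) ∧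
          ENNReal.ofReal (δ ^ ((1 : ℝ) / 2 + K * ε)) ≤
            ∑ p ∈ 𝒯, volume (Tube δ p.1 p.2 ∩ E) := by
  obtain ⟨F, hF⟩ := exists_finset_cover_by_tubes d
  refine ⟨5, by norm_num, 1, one_pos, fun ε hε _ => ?_⟩
  set M : ℝ := (F.card * C) ^ 2 + 1
  have hM0 : 0 < M := by positivity
  refine ⟨min (1 / 2) (M ^ (-(1 / ε))), by positivity,
    fun δ hδ hδ' E hE _ hTube hpairs => ?_⟩
  have hδ2 : δ ≤ 1 / 2 := hδ'.le.trans (min_le_left _ _)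
  have hδM : δ ^ ε * M < 1 := by
    have h := Real.rpow_lt_rpow hδ.le (hδ'.trans_le (min_le_right _ _)) hε
    rw [← Real.rpow_mul hM0.le, show -(1 / ε) * ε = -1 by field_simp, Real.rpow_neg_one] at h
    calc δ ^ ε * M < M⁻¹ * M := by gcongr
      _ = 1 := inv_mul_cancel₀ hM0.ne'
  set D : Euc d × Euc d → Set (Euc d) :=
    fun p => lineThrough p.1 p.2 ∩ closedBall (0 : Euc d) 2
  have hfin : ∀ p q, (D p).Nonempty → (D q).Nonempty → hausdorffEDist (D p) (D q) ≠ ⊤ :=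
    fun p q hp hq => hausdorffEDist_ne_top_of_nonempty_of_bounded hp hq
      (isBounded_closedBall.subset inter_subset_right)
      (isBounded_closedBall.subset inter_subset_right)
  obtain ⟨𝒯, hP, hsep, hmax⟩ := exists_finset_pairwise_card_or_maximal
    (fun p : Euc d × Euc d => p.2 ≠ 0 ∧ (D p).Nonempty ∧
      ENNReal.ofReal (δ ^ ((d : ℝ) - 1 / 2 + ε)) ≤ volume (Tube δ p.1 p.2 ∩ E))
    (fun p q => δ ≤ hausdorffDist (D p) (D q))
    (fun p q h => by rwa [hausdorffDist_comm]) ⌈δ ^ (1 - (d : ℝ) + 4 * ε)⌉₊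
  have hcard : δ ^ (1 - (d : ℝ) + 4 * ε) ≤ (𝒯.card : ℝ) := by
    rcases hmax with h | hmax
    · exact Nat.ceil_le.1 h
    set V : ℝ := C * δ ^ ((d : ℝ) - 1 / 2 - ε) with hV
    have hV0 : 0 ≤ V := by positivity
    set A : Euc d × Euc d → Set (Euc d) :=
      fun p => {x | x ∈ E ∧ ∃ y ∈ lineThrough p.1 p.2, dist x y ≤ 3 * δ}
    have hvolA : ∀ p ∈ 𝒯, volume (A p) ≤ ENNReal.ofReal (F.card * V) := by
      intro p hp
      have hsub : A p ⊆ ⋃ w ∈ F, E ∩ Tube δ (p.1 + δ • w) p.2 := by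
        rintro x ⟨hxE, y, hy, hxy⟩
        obtain ⟨w, hw, hxw⟩ := hF δ hδ p.1 p.2 x y hy hxy
        exact mem_iUnion₂.2 ⟨w, hw, hxE, hxw⟩
      calc volume (A p) ≤ ∑ w ∈ F, volume (E ∩ Tube δ (p.1 + δ • w) p.2) :=
            (measure_mono hsub).trans (measure_biUnion_finset_le _ _)
        _ ≤ ∑ _w ∈ F, ENNReal.ofReal V :=
            Finset.sum_le_sum fun w _ => hTube _ _ (hP p hp).1
        _ = ENNReal.ofReal (F.card * V) := by
            rw [Finset.sum_const, nsmul_eq_mul, ENNReal.ofReal_mul (Nat.cast_nonneg _),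
              ENNReal.ofReal_natCast]
    have hcover : {p : Euc d × Euc d | p.1 ∈ E ∧ p.2 ∈ E ∧ δ ^ ε ≤ dist p.1 p.2 ∧
        ∃ a v : Euc d, v ≠ 0 ∧ p.1 ∈ Tube δ a v ∧ p.2 ∈ Tube δ a v ∧
          ENNReal.ofReal (δ ^ ((d : ℝ) - 1 / 2 + ε)) ≤ volume (Tube δ a v ∩ E)} ⊆
        ⋃ q ∈ 𝒯, A q ×ˢ A q := by
      rintro ⟨x₁, x₂⟩ ⟨h₁, h₂, -, a, v, hv, hT₁, hT₂, hvol⟩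
      have hnear : ∀ x ∈ E, x ∈ Tube δ a v → ∃ y ∈ D (a, v), dist x y < 2 * δ :=
        fun x hx hxT => exists_dist_lt_of_mem_Tube hδ hδ2 (hE hx) hxT
      have hne : (D (a, v)).Nonempty := by
        obtain ⟨y, hy, -⟩ := hnear x₁ h₁ hT₁
        exact ⟨y, hy⟩
      obtain ⟨q, hq, hclose⟩ : ∃ q ∈ 𝒯, hausdorffDist (D (a, v)) (D q) < δ := by
        rcases hmax (a, v) ⟨hv, hne, hvol⟩ with h | ⟨q, hq, h⟩
        · exact ⟨_, h, by rwa [hausdorffDist_self_zero]⟩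
        · exact ⟨q, hq, not_le.1 h⟩
      have hmem : ∀ x ∈ E, x ∈ Tube δ a v → x ∈ A q := by
        intro x hx hxT
        obtain ⟨y, hy, hxy⟩ := hnear x hx hxT
        obtain ⟨z, hz, hyz⟩ := exists_dist_lt_of_hausdorffDist_lt hy hclose
          (hfin _ _ hne (hP q hq).2.1)
        exact ⟨hx, z, hz.1, by linarith [dist_triangle x y z]⟩
      exact mem_iUnion₂.2 ⟨q, hq, hmem x₁ h₁ hT₁, hmem x₂ h₂ hT₂⟩
    have hvol : ENNReal.ofReal (δ ^ ((d : ℝ) + ε)) ≤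
        ENNReal.ofReal (𝒯.card * (F.card * V) ^ 2) := by
      calc _ ≤ _ := hpairs
        _ ≤ ∑ q ∈ 𝒯, volume (A q ×ˢ A q) :=
            (measure_mono hcover).trans (measure_biUnion_finset_le _ _)
        _ ≤ ∑ _q ∈ 𝒯, ENNReal.ofReal ((F.card * V) ^ 2) := by
            refine Finset.sum_le_sum fun q hq => ?_
            rw [Measure.volume_eq_prod, Measure.prod_prod, sq,
              ENNReal.ofReal_mul (by positivity)]
            exact mul_le_mul' (hvolA q hq) (hvolA q hq)
        _ = _ := by
            rw [Finset.sum_const, nsmul_eq_mul, ENNReal.ofReal_mul (Nat.cast_nonneg _),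
              ENNReal.ofReal_natCast]
    have hreal := (ENNReal.ofReal_le_ofReal_iff (by positivity)).1 hvol
    by_contra! hlt
    have hle : 𝒯.card * (F.card * V) ^ 2 ≤ δ ^ ((d : ℝ) + ε) * (δ ^ ε * M) := by
      calc (𝒯.card : ℝ) * (F.card * V) ^ 2
          ≤ δ ^ (1 - (d : ℝ) + 4 * ε) * (F.card * V) ^ 2 := by gcongr
        _ = (δ ^ (1 - (d : ℝ) + 4 * ε) * (δ ^ ((d : ℝ) - 1 / 2 - ε) * δ ^ ((d : ℝ) - 1 / 2 - ε)))
              * (F.card * C) ^ 2 := by rw [hV]; ring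
        _ = (δ ^ ((d : ℝ) + ε) * δ ^ ε) * (F.card * C) ^ 2 := by
            simp only [← Real.rpow_add hδ]
            ring_nf
        _ ≤ (δ ^ ((d : ℝ) + ε) * δ ^ ε) * M := by
            gcongr
            linarith
        _ = _ := by ring
    have hpos : 0 < δ ^ ((d : ℝ) + ε) := by positivity
    nlinarith
  refine ⟨𝒯, fun p hp => (hP p hp).1, hsep, ?_, ?_⟩
  · exact (Real.rpow_le_rpow_of_exponent_ge hδ (by linarith) (by linarith)).trans hcard
  · calc ENNReal.ofReal (δ ^ ((1 : ℝ) / 2 + 5 * ε))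
        = ENNReal.ofReal (δ ^ (1 - (d : ℝ) + 4 * ε) * δ ^ ((d : ℝ) - 1 / 2 + ε)) := by
          rw [← Real.rpow_add hδ]
          ring_nf
      _ ≤ ENNReal.ofReal (𝒯.card * δ ^ ((d : ℝ) - 1 / 2 + ε)) := by gcongr
      _ = ∑ _p ∈ 𝒯, ENNReal.ofReal (δ ^ ((d : ℝ) - 1 / 2 + ε)) := by
          rw [Finset.sum_const, nsmul_eq_mul, ENNReal.ofReal_mul (Nat.cast_nonneg _),
            ENNReal.ofReal_natCast]
      _ ≤ _ := Finset.sum_le_sum fun p hp => (hP p hp).2.2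

end
end

section
/- Fix a constant C ≥ 1. There exist K ≥ 1 and ε_0 > 0 such that for every ε ∈ (0,ε_0) there exists δ_0 > 0 with the following property for all δ ∈ (0,δ_0). Let A, B ⊆ [−C,C] be compact (δ,1/2)_1 sets with constant C satisfying vol(A) ≥ δ^{1/2+ε} and vol(B) ≥ δ^{1/2+ε}, and let G ⊆ A × B be a compact set with vol_2(G) ≥ δ^{1+ε} such that the restricted sumset { a + b : (a,b) ∈ G } has vol_1 at most δ^{1/2−ε}. Then there exists a compact A' ⊆ A with vol(A') ≥ δ^{Kε}·vol(A) and vol(A' − A') ≤ δ^{−Kε}·vol(A), where A' − A' = { a − a' : a, a' ∈ A' }. -/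
open MeasureTheory Metric Set
open scoped ENNReal

noncomputable section

/-- Cavalieri upper bound: if the slices of `Q` over `W` have measure at most `c` and the other
slices are empty, then `Q` has measure at most `c * μ W`. -/
lemma measure_prod_le_of_slices {X Y : Type*} [MeasurableSpace X] [MeasurableSpace Y]
    {μ : Measure X} {ν : Measure Y} [SFinite ν] {Q : Set (X × Y)} (hQ : MeasurableSet Q)
    {W : Set X} (hW : MeasurableSet W) {c : ℝ≥0∞}
    (hmem : ∀ p ∈ Q, p.1 ∈ W) (hc : ∀ x ∈ W, ν (Prod.mk x ⁻¹' Q) ≤ c) :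
    (μ.prod ν) Q ≤ c * μ W := by
  rw [Measure.prod_apply hQ, ← setLIntegral_const, ← lintegral_indicator hW]
  refine lintegral_mono fun x => ?_
  by_cases hx : x ∈ W
  · simpa [hx] using hc x hx
  · have : Prod.mk x ⁻¹' Q = ∅ := by
      ext y
      simpa using fun h => hx (hmem _ h)
    simp [this]

/-- The common neighbourhood, in the second coordinate, of two points. -/
def commonNeighbors (G : Set (ℝ × ℝ)) (p : ℝ × ℝ) : Set ℝ :=
  {b | (p.1, b) ∈ G ∧ (p.2, b) ∈ G}

lemma measurable_volume_commonNeighbors {G : Set (ℝ × ℝ)} (hG : MeasurableSet G) :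
    Measurable fun p => volume (commonNeighbors G p) := by
  have hT : MeasurableSet {q : (ℝ × ℝ) × ℝ | (q.1.1, q.2) ∈ G ∧ (q.1.2, q.2) ∈ G} :=
    (hG.preimage (by fun_prop : Measurable fun q : (ℝ × ℝ) × ℝ => (q.1.1, q.2))).inter
      (hG.preimage (by fun_prop : Measurable fun q : (ℝ × ℝ) × ℝ => (q.1.2, q.2)))
  exact measurable_measure_prodMk_left hT

lemma commonNeighbors_swap (G : Set (ℝ × ℝ)) (a a' : ℝ) :
    commonNeighbors G (a, a') = commonNeighbors G (a', a) := by
  ext b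
  exact and_comm

lemma ENNReal.two_mul_mul_le_sq_add_sq (x y : ℝ≥0∞) : 2 * x * y ≤ x ^ 2 + y ^ 2 := by
  by_cases hx : x = ∞
  · simp [hx]
  by_cases hy : y = ∞
  · simp [hy]
  lift x to NNReal using hx
  lift y to NNReal using hy
  exact_mod_cast _root_.two_mul_le_add_sq x y

/-- Some vertex `b` has a large neighbourhood in which at most one eighth of the pairs have
few common neighbours. -/
lemma exists_neighborhood_few_bad_pairs {A B : Set ℝ} {G : Set (ℝ × ℝ)}
    (hA : MeasurableSet A) (hB : MeasurableSet B) (hG : MeasurableSet G) (hGAB : G ⊆ A ×ˢ B)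
    (hBtop : volume B ≠ ∞) (hB0 : volume B ≠ 0) {m γ : ℝ≥0∞} (hm0 : m ≠ 0) (hmtop : m ≠ ∞)
    (hm : m * volume B ≤ volume G) (hγ : 16 * γ * volume A ^ 2 ≤ m ^ 2 * volume B) :
    ∃ b : ℝ, 8 * volume {p : ℝ × ℝ | volume (commonNeighbors G p) < γ ∧
        (p.1, b) ∈ G ∧ (p.2, b) ∈ G} + m ^ 2 / 4 < volume {a | (a, b) ∈ G} ^ 2 := by
  set Q : Set ((ℝ × ℝ) × ℝ) := {q | volume (commonNeighbors G q.1) < γ ∧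
        (q.1.1, q.2) ∈ G ∧ (q.1.2, q.2) ∈ G} with hQdef
  have hQ : MeasurableSet Q :=
    (measurableSet_lt ((measurable_volume_commonNeighbors hG).comp measurable_fst)
      measurable_const).inter
    ((hG.preimage (by fun_prop : Measurable fun q : (ℝ × ℝ) × ℝ => (q.1.1, q.2))).inter
      (hG.preimage (by fun_prop : Measurable fun q : (ℝ × ℝ) × ℝ => (q.1.2, q.2))))
  have hQle : volume Q ≤ γ * volume A ^ 2 := by
    have hW : MeasurableSet (A ×ˢ A ∩ {p | volume (commonNeighbors G p) < γ}) :=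
      (hA.prod hA).inter (measurableSet_lt (measurable_volume_commonNeighbors hG)
        measurable_const)
    have := measure_prod_le_of_slices (μ := (volume : Measure (ℝ × ℝ)))
      (ν := (volume : Measure ℝ)) hQ hW (c := γ)
      (fun q hq => ⟨⟨(hGAB hq.2.1).1, (hGAB hq.2.2).1⟩, hq.1⟩)
      (fun p hp => (measure_mono fun b hb => hb.2).trans hp.2.le)
    refine this.trans ?_
    gcongr
    refine (measure_mono inter_subset_left).trans_eq ?_
    rw [Measure.volume_eq_prod, Measure.prod_prod, sq]
  by_contra! hcon
  have hNint : ∫⁻ b in B, volume {a | (a, b) ∈ G} = volume G := by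
    rw [Measure.volume_eq_prod, Measure.prod_apply_symm hG, ← lintegral_indicator hB]
    refine lintegral_congr fun b => ?_
    by_cases hb : b ∈ B
    · simp [hb, preimage]
    · have : (fun x : ℝ => (x, b)) ⁻¹' G = ∅ := by
        ext a
        simpa using fun h => hb (hGAB h).2
      simp [hb, this]
  have hQint : ∫⁻ b in B, volume {p : ℝ × ℝ | volume (commonNeighbors G p) < γ ∧
        (p.1, b) ∈ G ∧ (p.2, b) ∈ G} ≤ volume Q := by
    rw [Measure.volume_eq_prod (ℝ × ℝ) ℝ, Measure.prod_apply_symm hQ]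
    exact setLIntegral_le_lintegral _ _
  have hNmeas : Measurable fun b : ℝ => volume {a | (a, b) ∈ G} :=
    measurable_measure_prodMk_right hG
  have hQmeas : Measurable fun b : ℝ => volume {p : ℝ × ℝ | volume (commonNeighbors G p) < γ ∧
        (p.1, b) ∈ G ∧ (p.2, b) ∈ G} := measurable_measure_prodMk_right hQ
  have key : 2 * m * volume G ≤
      8 * (γ * volume A ^ 2) + (m ^ 2 / 4 + m ^ 2) * volume B := by
    calc 2 * m * volume G = ∫⁻ b in B, 2 * m * volume {a | (a, b) ∈ G} := by
          rw [lintegral_const_mul _ hNmeas, hNint]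
      _ ≤ ∫⁻ b in B, (8 * volume {p : ℝ × ℝ | volume (commonNeighbors G p) < γ ∧
            (p.1, b) ∈ G ∧ (p.2, b) ∈ G} + (m ^ 2 / 4 + m ^ 2)) := by
          refine lintegral_mono fun b => ?_
          refine (ENNReal.two_mul_mul_le_sq_add_sq _ _).trans ?_
          rw [add_comm, ← add_assoc]
          gcongr
          exact hcon b
      _ ≤ _ := by
          rw [lintegral_add_right _ measurable_const, lintegral_const_mul _ hQmeas,
            setLIntegral_const]
          gcongr
          exact hQint.trans hQle
  have key2 : 2 * m * (m * volume B) * 2 ≤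
      m ^ 2 * volume B + 2 * ((m ^ 2 / 4 + m ^ 2) * volume B) := by
    calc 2 * m * (m * volume B) * 2 ≤ 2 * m * volume G * 2 := by gcongr
      _ ≤ (8 * (γ * volume A ^ 2) + (m ^ 2 / 4 + m ^ 2) * volume B) * 2 := by gcongr
      _ = 16 * γ * volume A ^ 2 + 2 * ((m ^ 2 / 4 + m ^ 2) * volume B) := by ring
      _ ≤ _ := by gcongr
  generalize volume B = β at *
  lift m to NNReal using hmtop
  lift β to NNReal using hBtop
  have h4 : ((m : ℝ≥0∞) ^ 2 / 4) = ((m ^ 2 / 4 : NNReal) : ℝ≥0∞) := by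
    rw [ENNReal.coe_div (by norm_num)]; norm_cast
  rw [h4] at key2
  norm_cast at key2 hm0 hB0
  have hm' : (0 : ℝ) < m := by positivity
  have hβ' : (0 : ℝ) < β := by positivity
  have key3 : (2 * m * (m * β) * 2 : ℝ) ≤ m ^ 2 * β + 2 * ((m ^ 2 / 4 + m ^ 2) * β) := by
    exact_mod_cast key2
  have hpos := mul_pos (pow_pos hm' 2) hβ'
  nlinarith

/-- A large set of vertices any two of which are both well connected to many common
vertices. -/
lemma exists_well_connected_subset {A B : Set ℝ} {G : Set (ℝ × ℝ)}
    (hA : MeasurableSet A) (hB : MeasurableSet B) (hG : MeasurableSet G) (hGAB : G ⊆ A ×ˢ B)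
    (hAtop : volume A ≠ ∞)
    (hBtop : volume B ≠ ∞) (hB0 : volume B ≠ 0) {m γ : ℝ≥0∞} (hm0 : m ≠ 0) (hmtop : m ≠ ∞)
    (hm : m * volume B ≤ volume G) (hγ : 16 * γ * volume A ^ 2 ≤ m ^ 2 * volume B) :
    ∃ A' : Set ℝ, A' ⊆ A ∧ IsCompact A' ∧ m / 8 ≤ volume A' ∧ ∀ a ∈ A', ∀ a' ∈ A',
      m / 4 ≤ volume {x | γ ≤ volume (commonNeighbors G (a, x)) ∧
        γ ≤ volume (commonNeighbors G (a', x))} := by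
  obtain ⟨b, hb⟩ := exists_neighborhood_few_bad_pairs hA hB hG hGAB hBtop hB0 hm0 hmtop hm hγ
  set N : Set ℝ := {a | (a, b) ∈ G} with hN
  set R : Set (ℝ × ℝ) := {p : ℝ × ℝ | volume (commonNeighbors G p) < γ ∧
        (p.1, b) ∈ G ∧ (p.2, b) ∈ G} with hR
  have hNmeas : MeasurableSet N := hG.preimage (by fun_prop : Measurable fun a : ℝ => (a, b))
  have hRmeas : MeasurableSet R :=
    (measurableSet_lt (measurable_volume_commonNeighbors hG) measurable_const).inter
      ((hNmeas.preimage measurable_fst).inter (hNmeas.preimage measurable_snd))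
  have hNA : N ⊆ A := fun a ha => (hGAB ha).1
  have hNtop : volume N ≠ ∞ := measure_ne_top_of_subset hNA hAtop
  have hslice : Measurable fun a : ℝ => volume (Prod.mk a ⁻¹' R) :=
    measurable_measure_prodMk_left hRmeas
  have hNlt : m / 2 < volume N := by
    have h1 : (m / 2) ^ 2 < volume N ^ 2 := by
      refine lt_of_le_of_lt ?_ hb
      rw [div_eq_mul_inv, mul_pow, ← ENNReal.inv_pow, show (2 : ℝ≥0∞) ^ 2 = 4 by norm_num,
        ← div_eq_mul_inv]
      exact le_add_self
    exact lt_of_pow_lt_pow_left' 2 h1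
  have hNpos : volume N ≠ 0 := (zero_le.trans_lt hNlt).ne'
  have hR8 : 8 * volume R ≤ volume N ^ 2 := (le_self_add.trans hb.le)
  have hmarkov : volume N / 4 * volume {a | volume N / 4 ≤ volume (Prod.mk a ⁻¹' R)}
      ≤ volume R := by
    conv_rhs => rw [Measure.volume_eq_prod, Measure.prod_apply hRmeas]
    exact mul_meas_ge_le_lintegral hslice _
  set A₁ : Set ℝ := N ∩ {a | volume (Prod.mk a ⁻¹' R) ≤ volume N / 4} with hA₁
  have hA₁meas : MeasurableSet A₁ := hNmeas.inter (measurableSet_le hslice measurable_const)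
  have hA₁vol : volume N / 2 ≤ volume A₁ := by
    have hcov : volume N ≤
        volume A₁ + volume {a | volume N / 4 ≤ volume (Prod.mk a ⁻¹' R)} := by
      refine (measure_mono fun a ha => ?_).trans (measure_union_le _ _)
      rcases le_total (volume (Prod.mk a ⁻¹' R)) (volume N / 4) with h | h
      · exact Or.inl ⟨ha, h⟩
      · exact Or.inr h
    have hcan : 2 * volume {a | volume N / 4 ≤ volume (Prod.mk a ⁻¹' R)} ≤ volume N := by
      have h8 : volume N * (2 * volume {a | volume N / 4 ≤ volume (Prod.mk a ⁻¹' R)})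
          ≤ volume N * volume N := by
        calc _ = 8 * (volume N / 4 * volume {a | volume N / 4 ≤ volume (Prod.mk a ⁻¹' R)}) := by
              rw [show (8 : ℝ≥0∞) = 2 * 4 by norm_num, mul_assoc, ← mul_assoc 4,
                ENNReal.mul_div_cancel (by norm_num) (by norm_num)]
              ring
          _ ≤ 8 * volume R := by gcongr
          _ ≤ _ := by rw [← sq]; exact hR8
      exact (ENNReal.mul_le_mul_iff_right hNpos hNtop).1 h8
    refine ENNReal.div_le_of_le_mul ?_
    have hlow : volume N + volume N ≤ volume A₁ * 2 + volume N := by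
      calc volume N + volume N ≤ _ := add_le_add hcov hcov
        _ = volume A₁ * 2 + 2 * volume {a | volume N / 4 ≤ volume (Prod.mk a ⁻¹' R)} := by ring
        _ ≤ _ := by gcongr
    exact (ENNReal.add_le_add_iff_right hNtop).1 hlow
  have hA₁lt : m / 8 < volume A₁ := by
    refine lt_of_lt_of_le ?_ hA₁vol
    refine lt_of_le_of_lt ?_ (ENNReal.div_lt_div_right (by norm_num) (by norm_num) hNlt)
    rw [div_eq_mul_inv, div_eq_mul_inv, div_eq_mul_inv, mul_assoc,
      ← ENNReal.mul_inv (by norm_num) (by norm_num)]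
    gcongr
    norm_num
  obtain ⟨A', hA'A₁, hA'c, hA'lt⟩ := hA₁meas.exists_lt_isCompact hA₁lt
  refine ⟨A', fun a ha => hNA (hA'A₁ ha).1, hA'c, hA'lt.le, fun a ha a' ha' => ?_⟩
  set X := {x | γ ≤ volume (commonNeighbors G (a, x)) ∧
        γ ≤ volume (commonNeighbors G (a', x))}
  have hcov : volume N ≤
      volume X + (volume (Prod.mk a ⁻¹' R) + volume (Prod.mk a' ⁻¹' R)) := by
    refine (measure_mono (t := X ∪ (Prod.mk a ⁻¹' R ∪ Prod.mk a' ⁻¹' R))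
      fun x hx => ?_).trans ((measure_union_le _ _).trans (by gcongr; exact measure_union_le _ _))
    by_cases h1 : γ ≤ volume (commonNeighbors G (a, x))
    · by_cases h2 : γ ≤ volume (commonNeighbors G (a', x))
      · exact Or.inl ⟨h1, h2⟩
      · exact Or.inr (Or.inr ⟨not_le.1 h2, (hA'A₁ ha').1, hx⟩)
    · exact Or.inr (Or.inl ⟨not_le.1 h1, (hA'A₁ ha).1, hx⟩)
  have hquart : volume N / 4 + volume N / 4 = volume N / 2 := by
    rw [ENNReal.div_add_div_same, ← two_mul, show (4 : ℝ≥0∞) = 2 * 2 by norm_num,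
      ENNReal.mul_div_mul_left _ _ (by norm_num) (by norm_num)]
  have hhalf : volume N / 2 + volume N / 2 ≤ volume X + volume N / 2 := by
    rw [ENNReal.add_halves, ← hquart]
    exact hcov.trans (by gcongr; exacts [(hA'A₁ ha).2, (hA'A₁ ha').2])
  have hX : volume N / 2 ≤ volume X :=
    (ENNReal.add_le_add_iff_right (ENNReal.div_ne_top hNtop (by norm_num))).1 hhalf
  refine le_trans ?_ hX
  refine le_trans ?_ (ENNReal.div_le_div_right hNlt.le 2)
  rw [div_eq_mul_inv, div_eq_mul_inv, div_eq_mul_inv, mul_assoc,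
    ← ENNReal.mul_inv (by norm_num) (by norm_num)]
  norm_num

lemma measurableSet_representations {S : Set ℝ} (hS : MeasurableSet S) :
    MeasurableSet {q : ((ℝ × ℝ) × ℝ) × ℝ | (q.1.1.1 ∈ S ∧ q.1.1.2 ∈ S) ∧
      q.1.2 + q.1.1.1 ∈ S ∧ q.1.2 + q.1.1.2 + q.2 ∈ S} :=
  ((hS.preimage (by fun_prop : Measurable fun q : ((ℝ × ℝ) × ℝ) × ℝ => q.1.1.1)).inter
    (hS.preimage (by fun_prop : Measurable fun q : ((ℝ × ℝ) × ℝ) × ℝ => q.1.1.2))).inter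
  ((hS.preimage (by fun_prop : Measurable fun q : ((ℝ × ℝ) × ℝ) × ℝ => q.1.2 + q.1.1.1)).inter
    (hS.preimage
      (by fun_prop : Measurable fun q : ((ℝ × ℝ) × ℝ) × ℝ => q.1.2 + q.1.1.2 + q.2)))

/-- Integrating over `t` the measure of the set of representations
`t = s₁ - s₂ + s₃ - s₄` with all `sᵢ ∈ S` gives at most `|S|⁴`. -/
lemma lintegral_volume_representations_le {S : Set ℝ} (hS : MeasurableSet S) :
    ∫⁻ t : ℝ, volume {v : (ℝ × ℝ) × ℝ | (v.1.1 ∈ S ∧ v.1.2 ∈ S) ∧ v.2 + v.1.1 ∈ S ∧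
      v.2 + v.1.2 + t ∈ S} ≤ volume S ^ 4 := by
  set W : Set ((ℝ × ℝ) × ℝ) := {v | v.1 ∈ S ×ˢ S ∧ v.2 + v.1.1 ∈ S}
  have hW : MeasurableSet W :=
    ((hS.prod hS).preimage measurable_fst).inter
      (hS.preimage (by fun_prop : Measurable fun v : (ℝ × ℝ) × ℝ => v.2 + v.1.1))
  set Q : Set (((ℝ × ℝ) × ℝ) × ℝ) := {q | (q.1.1.1 ∈ S ∧ q.1.1.2 ∈ S) ∧
      q.1.2 + q.1.1.1 ∈ S ∧ q.1.2 + q.1.1.2 + q.2 ∈ S}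
  have hQ : MeasurableSet Q := measurableSet_representations hS
  have hint : ∫⁻ t : ℝ, volume {v : (ℝ × ℝ) × ℝ | (v.1.1 ∈ S ∧ v.1.2 ∈ S) ∧
      v.2 + v.1.1 ∈ S ∧ v.2 + v.1.2 + t ∈ S} = volume Q := by
    rw [Measure.volume_eq_prod ((ℝ × ℝ) × ℝ) ℝ, Measure.prod_apply_symm hQ]
    rfl
  rw [hint]
  have hWle : volume W ≤ volume S * volume (S ×ˢ S) :=
    measure_prod_le_of_slices hW (hS.prod hS) (fun v hv => hv.1) fun p hp => by
      calc volume (Prod.mk p ⁻¹' W) ≤ volume ((fun x => x + p.1) ⁻¹' S) :=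
            measure_mono fun x hx => hx.2
        _ = volume S := measure_preimage_add_right _ _ _
  have hQle : volume Q ≤ volume S * volume W :=
    measure_prod_le_of_slices hQ hW (fun q hq => ⟨hq.1, hq.2.1⟩) fun v hv => by
      calc volume (Prod.mk v ⁻¹' Q) ≤ volume ((fun x => v.2 + v.1.2 + x) ⁻¹' S) :=
            measure_mono fun x hx => hx.2.2
        _ = volume S := measure_preimage_add _ _ _
  calc volume Q ≤ volume S * (volume S * volume (S ×ˢ S)) := hQle.trans (by gcongr)
    _ = volume S ^ 4 := by
      rw [Measure.volume_eq_prod, Measure.prod_prod]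
      ring

/-- If `a` and `a'` are well connected to many common vertices, then `a - a'` has many
representations as an alternating sum of four elements of the restricted sumset. -/
lemma le_volume_representations {G : Set (ℝ × ℝ)} (hG : MeasurableSet G) {S : Set ℝ}
    (hS : ∀ p ∈ G, p.1 + p.2 ∈ S) (a a' : ℝ) (γ : ℝ≥0∞) :
    γ ^ 2 * volume {x | γ ≤ volume (commonNeighbors G (a, x)) ∧
        γ ≤ volume (commonNeighbors G (a', x))} ≤
      volume {v : (ℝ × ℝ) × ℝ | (v.1.1 ∈ S ∧ v.1.2 ∈ S) ∧ v.2 + v.1.1 ∈ S ∧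
        v.2 + v.1.2 + (a - a') ∈ S} := by
  set P : Set ((ℝ × ℝ) × ℝ) := {v | v.1.1 ∈ commonNeighbors G (a, v.2) ∧
    v.1.2 ∈ commonNeighbors G (a', v.2)}
  have hP : MeasurableSet P :=
    ((hG.preimage (by fun_prop : Measurable fun v : (ℝ × ℝ) × ℝ => (a, v.1.1))).inter
      (hG.preimage (by fun_prop : Measurable fun v : (ℝ × ℝ) × ℝ => (v.2, v.1.1)))).inter
    ((hG.preimage (by fun_prop : Measurable fun v : (ℝ × ℝ) × ℝ => (a', v.1.2))).inter
      (hG.preimage (by fun_prop : Measurable fun v : (ℝ × ℝ) × ℝ => (v.2, v.1.2))))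
  have hPle : γ ^ 2 * volume {x | γ ≤ volume (commonNeighbors G (a, x)) ∧
        γ ≤ volume (commonNeighbors G (a', x))} ≤ volume P := by
    rw [Measure.volume_eq_prod (ℝ × ℝ) ℝ, Measure.prod_apply_symm hP]
    have hslice : ∀ x : ℝ, volume ((fun p : ℝ × ℝ => (p, x)) ⁻¹' P) =
        volume (commonNeighbors G (a, x)) * volume (commonNeighbors G (a', x)) := fun x => by
      rw [← Measure.prod_prod]
      rfl
    refine le_trans ?_ (mul_meas_ge_le_lintegral (measurable_measure_prodMk_right hP) (γ ^ 2))
    gcongr with x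
    rintro ⟨h1, h2⟩
    rw [hslice, sq]
    gcongr
  refine hPle.trans ?_
  have : (volume : Measure (ℝ × ℝ)).IsAddLeftInvariant :=
    Measure.prod.instIsAddLeftInvariant
  have : (volume : Measure ((ℝ × ℝ) × ℝ)).IsAddLeftInvariant :=
    Measure.prod.instIsAddLeftInvariant
  rw [← measure_preimage_add volume (((a, a'), -a) : (ℝ × ℝ) × ℝ)
    {v : (ℝ × ℝ) × ℝ | (v.1.1 ∈ S ∧ v.1.2 ∈ S) ∧ v.2 + v.1.1 ∈ S ∧
        v.2 + v.1.2 + (a - a') ∈ S}]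
  refine measure_mono ?_
  rintro ⟨⟨y, z⟩, x⟩ ⟨⟨h1, h2⟩, h3, h4⟩
  refine ⟨⟨hS _ h1, hS _ h3⟩, ?_, ?_⟩
  · convert hS _ h2 using 1
    simp
    ring
  · convert hS _ h4 using 1
    simp
    ring

/-- The Balog–Szemerédi–Gowers theorem for Lebesgue measure on the line. -/
lemma exists_subset_small_difference {A B : Set ℝ} {G : Set (ℝ × ℝ)} {S : Set ℝ}
    (hA : MeasurableSet A) (hB : MeasurableSet B) (hG : MeasurableSet G) (hGAB : G ⊆ A ×ˢ B)
    (hS : MeasurableSet S) (hGS : ∀ p ∈ G, p.1 + p.2 ∈ S) (hAtop : volume A ≠ ∞)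
    (hBtop : volume B ≠ ∞) (hB0 : volume B ≠ 0) {m γ : ℝ≥0∞} (hm0 : m ≠ 0) (hmtop : m ≠ ∞)
    (hm : m * volume B ≤ volume G) (hγ : 16 * γ * volume A ^ 2 ≤ m ^ 2 * volume B) :
    ∃ A' : Set ℝ, A' ⊆ A ∧ IsCompact A' ∧ m / 8 ≤ volume A' ∧
      γ ^ 2 * (m / 4) * volume {t : ℝ | ∃ a ∈ A', ∃ a' ∈ A', t = a - a'} ≤ volume S ^ 4 := by
  obtain ⟨A', hA'A, hA'c, hA'vol, hconn⟩ :=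
    exists_well_connected_subset hA hB hG hGAB hAtop hBtop hB0 hm0 hmtop hm hγ
  refine ⟨A', hA'A, hA'c, hA'vol, ?_⟩
  refine le_trans ?_ (lintegral_volume_representations_le hS)
  refine le_trans ?_ (mul_meas_ge_le_lintegral
    (measurable_measure_prodMk_right (measurableSet_representations hS)) (γ ^ 2 * (m / 4)))
  gcongr with t
  rintro ⟨a, ha, a', ha', rfl⟩
  refine le_trans ?_ (le_volume_representations hG hGS a a' γ)
  have hlarge := hconn a ha a' ha'
  gcongr

/-- **A version of the Gowers–Balog–Szemerédi theorem (Lemma 2.7).** If a large portion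
`G` of `A × B` has small restricted sumset, then a large subset `A'` of `A` has small
difference set. -/
theorem gowers_balog_szemeredi (C : ℝ) (hC : 1 ≤ C) :
    ∃ K : ℝ, 1 ≤ K ∧ ∃ ε₀ : ℝ, 0 < ε₀ ∧ ∀ ε : ℝ, 0 < ε → ε < ε₀ →
      ∃ δ₀ : ℝ, 0 < δ₀ ∧ ∀ δ : ℝ, 0 < δ → δ < δ₀ →
      ∀ (A B : Set ℝ) (G : Set (ℝ × ℝ)),
        IsCompact A → IsCompact B →
        A ⊆ Icc (-C) C → B ⊆ Icc (-C) C →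
        IsDeltaRhoSet1 δ (1 / 2) C A → IsDeltaRhoSet1 δ (1 / 2) C B →
        ENNReal.ofReal (δ ^ ((1 : ℝ) / 2 + ε)) ≤ volume A →
        ENNReal.ofReal (δ ^ ((1 : ℝ) / 2 + ε)) ≤ volume B →
        IsCompact G → G ⊆ A ×ˢ B →
        ENNReal.ofReal (δ ^ ((1 : ℝ) + ε)) ≤ volume G →
        volume {s : ℝ | ∃ p ∈ G, s = p.1 + p.2} ≤ ENNReal.ofReal (δ ^ ((1 : ℝ) / 2 - ε)) →
        ∃ A' : Set ℝ, A' ⊆ A ∧ IsCompact A' ∧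
          ENNReal.ofReal (δ ^ (K * ε)) * volume A ≤ volume A' ∧
          volume {t : ℝ | ∃ a ∈ A', ∃ a' ∈ A', t = a - a'}
            ≤ ENNReal.ofReal (δ ^ (-(K * ε))) * volume A := by
  have hD : 1 ≤ C ^ 2 := one_le_pow₀ hC
  obtain ⟨D, hDC⟩ : ∃ D, D = C ^ 2 := ⟨_, rfl⟩
  rw [← hDC] at hD
  have hD0 : 0 < D := by linarith
  refine ⟨13, by norm_num, 1, one_pos, fun ε hε _ => ?_⟩
  refine ⟨min 1 ((1 / (1024 * D ^ 9)) ^ (1 / ε)), by positivity, ?_⟩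
  intro δ hδ hδ₀ A B G hA hB hAC hBC hAδ hBδ hAvol hBvol hG hGAB hGvol hSvol
  have hδ1 : δ < 1 := hδ₀.trans_le (min_le_left _ _)
  obtain ⟨h, hh⟩ : ∃ h, h = δ ^ (1 / 2 : ℝ) := ⟨_, rfl⟩
  obtain ⟨u, hu⟩ : ∃ u, u = δ ^ ε := ⟨_, rfl⟩
  have hh0 : 0 < h := hh ▸ Real.rpow_pos_of_pos hδ _
  have hu0 : 0 < u := hu ▸ Real.rpow_pos_of_pos hδ _
  have huD : u ≤ 1 / (1024 * D ^ 9) := by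
    rw [hu]
    refine (Real.rpow_le_rpow hδ.le (hδ₀.le.trans (min_le_right _ _)) hε.le).trans_eq ?_
    rw [← Real.rpow_mul (by positivity), one_div_mul_cancel hε.ne', Real.rpow_one]
  have hhu : δ ^ ((1 : ℝ) / 2 + ε) = h * u := by rw [Real.rpow_add hδ, hh, hu]
  have hhhu : δ ^ ((1 : ℝ) + ε) = h * h * u := by
    rw [hh, hu, ← Real.rpow_add hδ, ← Real.rpow_add hδ]
    norm_num
  have hhdivu : δ ^ ((1 : ℝ) / 2 - ε) = h / u := by rw [Real.rpow_sub hδ, hh, hu]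
  have hu13 : δ ^ (13 * ε) = u ^ 13 := by
    rw [hu, ← Real.rpow_natCast, ← Real.rpow_mul hδ.le, mul_comm]
    norm_num
  have hu13' : δ ^ (-(13 * ε)) = (u ^ 13)⁻¹ := by rw [Real.rpow_neg hδ.le, hu13]
  rw [hhu] at hAvol hBvol
  rw [hhhu] at hGvol
  rw [hhdivu] at hSvol
  rw [hu13, hu13']
  have hupper : ∀ E : Set ℝ, E ⊆ Icc (-C) C → IsDeltaRhoSet1 δ (1 / 2) C E →
      volume E ≤ ENNReal.ofReal (D * h) := by
    intro E hE hEδ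
    have hball : E ∩ closedBall 0 C = E := by
      rw [inter_eq_left, Real.closedBall_eq_Icc]
      simpa using hE
    have := hEδ 0 C (by linarith)
    rw [hball] at this
    refine this.trans (ENNReal.ofReal_le_ofReal ?_)
    have hCpow : C ^ (1 / 2 : ℝ) ≤ C := by
      simpa using Real.rpow_le_rpow_of_exponent_le hC (by norm_num : (1 / 2 : ℝ) ≤ 1)
    rw [show (1 - 1 / 2 : ℝ) = 1 / 2 by norm_num, ← hh, hDC]
    calc C * h * C ^ (1 / 2 : ℝ) ≤ C * h * C := by gcongr
      _ = C ^ 2 * h := by ring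
  have hAup := hupper A hAC hAδ
  have hBup := hupper B hBC hBδ
  have hSeq : {s : ℝ | ∃ p ∈ G, s = p.1 + p.2} = (fun p : ℝ × ℝ => p.1 + p.2) '' G := by
    ext s
    simp only [mem_ofPred_eq, mem_image, eq_comm]
  have hSmeas : MeasurableSet {s : ℝ | ∃ p ∈ G, s = p.1 + p.2} := by
    rw [hSeq]
    exact (hG.image (by fun_prop)).measurableSet
  have hm0 : 0 < h * u / D := by positivity
  have hγ0 : 0 < u ^ 3 * h / (16 * D ^ 4) := by positivity
  obtain ⟨A', hA'A, hA'c, hA'vol, hdiff⟩ := exists_subset_small_difference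
    (m := ENNReal.ofReal (h * u / D)) (γ := ENNReal.ofReal (u ^ 3 * h / (16 * D ^ 4)))
    hA.measurableSet hB.measurableSet hG.measurableSet hGAB hSmeas
    (fun p hp => ⟨p, hp, rfl⟩) hA.measure_ne_top hB.measure_ne_top
    ((ENNReal.ofReal_pos.2 (by positivity)).trans_le hBvol).ne'
    (ENNReal.ofReal_pos.2 hm0).ne' ENNReal.ofReal_ne_top
    (by
      calc _ ≤ ENNReal.ofReal (h * u / D) * ENNReal.ofReal (D * h) := by gcongr
        _ = ENNReal.ofReal (h * h * u) := by
          rw [← ENNReal.ofReal_mul hm0.le]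
          congr 1
          field_simp
        _ ≤ _ := hGvol)
    (by
      calc _ ≤ 16 * ENNReal.ofReal (u ^ 3 * h / (16 * D ^ 4)) * ENNReal.ofReal (D * h) ^ 2 := by
            gcongr
        _ = ENNReal.ofReal (h * u / D) ^ 2 * ENNReal.ofReal (h * u) := by
          rw [← ENNReal.ofReal_pow (by positivity), ← ENNReal.ofReal_pow (by positivity),
            ← ENNReal.ofReal_mul (by positivity),
            show (16 : ℝ≥0∞) = ENNReal.ofReal 16 by norm_num,
            ← ENNReal.ofReal_mul (by positivity), ← ENNReal.ofReal_mul (by positivity)]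
          congr 1
          field_simp
        _ ≤ _ := by gcongr)
  have huD' : u * (1024 * D ^ 9) ≤ 1 := by rwa [le_div_iff₀ (by positivity)] at huD
  refine ⟨A', hA'A, hA'c, le_trans ?_ hA'vol, ?_⟩
  · calc _ ≤ ENNReal.ofReal (u ^ 13) * ENNReal.ofReal (D * h) := by gcongr
      _ = ENNReal.ofReal (u ^ 13 * (D * h)) := by rw [← ENNReal.ofReal_mul (by positivity)]
      _ ≤ ENNReal.ofReal (h * u / D / 8) := by
        refine ENNReal.ofReal_le_ofReal ?_
        have hu1 : u ≤ 1 := by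
          refine le_trans ?_ huD'
          exact le_mul_of_one_le_right hu0.le (by linarith [one_le_pow₀ hD (n := 9)])
        have hu12 : u ^ 12 * (8 * D ^ 2) ≤ 1 := by
          refine le_trans ?_ huD'
          gcongr
          · exact pow_le_of_le_one hu0.le hu1 (by norm_num)
          · norm_num
          · norm_num
        rw [div_div, le_div_iff₀ (by positivity)]
        calc u ^ 13 * (D * h) * (D * 8) = h * u * (u ^ 12 * (8 * D ^ 2)) := by ring
          _ ≤ h * u * 1 := by gcongr
          _ = h * u := mul_one _
      _ = _ := by
        rw [ENNReal.ofReal_div_of_pos (by norm_num)]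
        norm_num
  · have hc : ENNReal.ofReal (u ^ 3 * h / (16 * D ^ 4)) ^ 2 * (ENNReal.ofReal (h * u / D) / 4) =
        ENNReal.ofReal (u ^ 7 * h ^ 3 / (1024 * D ^ 9)) := by
      rw [show (4 : ℝ≥0∞) = ENNReal.ofReal 4 by norm_num,
        ← ENNReal.ofReal_div_of_pos (by norm_num), ← ENNReal.ofReal_pow (by positivity),
        ← ENNReal.ofReal_mul (by positivity)]
      congr 1
      field_simp
      norm_num
    rw [hc] at hdiff
    have hc0 : 0 < u ^ 7 * h ^ 3 / (1024 * D ^ 9) := by positivity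
    calc _ ≤ ENNReal.ofReal ((h / u) ^ 4) /
          ENNReal.ofReal (u ^ 7 * h ^ 3 / (1024 * D ^ 9)) := by
          rw [ENNReal.le_div_iff_mul_le (Or.inl (ENNReal.ofReal_pos.2 hc0).ne')
            (Or.inl ENNReal.ofReal_ne_top), mul_comm, ENNReal.ofReal_pow (by positivity)]
          exact hdiff.trans (by gcongr)
      _ = ENNReal.ofReal ((h / u) ^ 4 / (u ^ 7 * h ^ 3 / (1024 * D ^ 9))) :=
          (ENNReal.ofReal_div_of_pos hc0).symm
      _ ≤ ENNReal.ofReal ((u ^ 13)⁻¹ * (h * u)) := by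
        refine ENNReal.ofReal_le_ofReal ?_
        calc (h / u) ^ 4 / (u ^ 7 * h ^ 3 / (1024 * D ^ 9))
            = h * (u ^ 12)⁻¹ * (u * (1024 * D ^ 9)) := by field_simp
          _ ≤ h * (u ^ 12)⁻¹ * 1 := by gcongr
          _ = (u ^ 13)⁻¹ * (h * u) := by field_simp
      _ ≤ _ := by
        rw [ENNReal.ofReal_mul (by positivity)]
        gcongr

end
end
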